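/- Let 0 < q, r < ∞ and 1 < p < ∞ with q < p ≤ r, let u, w be weights on (0,∞), and let v be a weight on (0,∞) such that ∫₀^x v(t)^{1-p'} dt < ∞ for every x ∈ (0,∞). Then there exists a constant C > 0 such that (∫₀^∞ (∫_x^∞ (∫₀^t h(s) ds)^r u(t) dt)^{q/r} w(x) dx)^{1/q} ≤ C (∫₀^∞ h(t)^p v(t) dt)^{1/p} for all h ∈ M⁺(0,∞) if and only if F₃ < ∞ and F₄ < ∞, where F₃ := (∫₀^∞ (sup_{t∈[x,∞)} (∫_t^∞ u)^{1/r} (∫₀^t v^{1-p'})^{1/p'})^{pq/(p-q)} (∫₀^x w)^{q/(p-q)} w(x) dx)^{(p-q)/(pq)} and F₄ := (∫₀^∞ (∫_x^∞ (∫_t^∞ u)^{q/r} w(t) dt)^{q/(p-q)} (∫_x^∞ u)^{q/r} (∫₀^x v^{1-p'})^{(p-1)q/(p-q)} w(x) dx)^{(p-q)/(pq)}. -/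

import Mathlib

open MeasureTheory Set ENNReal NNReal

noncomputable section

/-- Lebesgue measure restricted to `(0, ∞)`. -/
def mu0 : Measure ℝ := volume.restrict (Ioi (0 : ℝ))

/-- A weight on `(0, ∞)`: a measurable function that is positive (and finite) a.e. on `(0, ∞)`. -/
def IsWeight (v : ℝ → ℝ≥0∞) : Prop :=
  Measurable v ∧ ∀ᵐ x ∂mu0, 0 < v x ∧ v x < ∞

/-! ### Measures of half-lines -/

theorem measure_le_of_forall_Iic {α : Type*} [LinearOrder α] [TopologicalSpace α] [OrderTopology α]
    [SecondCountableTopology α] [MeasurableSpace α] (ν : Measure α) {A : Set α}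
    {c : ℝ≥0∞} (h : ∀ x ∈ A, ν (Iic x) ≤ c) : ν A ≤ c := by
  by_cases hm : ∃ m ∈ A, ∀ x ∈ A, x ≤ m
  · obtain ⟨m, hmA, hm⟩ := hm
    exact (measure_mono fun x hx => hm x hx).trans (h m hmA)
  · push Not at hm
    obtain ⟨T, hTA, hTc, hT⟩ := TopologicalSpace.isOpen_biUnion_countable A (fun x => Iio x)
      (fun x _ => isOpen_Iio)
    have hAT : A ⊆ ⋃ x ∈ T, Iio x := by
      rw [hT]
      intro x hx
      obtain ⟨y, hy, hxy⟩ := hm x hx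
      exact mem_biUnion hy hxy
    refine (measure_mono hAT).trans ?_
    rw [measure_biUnion_eq_iSup hTc]
    · exact iSup₂_le fun x hx => (measure_mono Iio_subset_Iic_self).trans (h x (hTA hx))
    · intro x hx y hy
      rcases le_total x y with hxy | hxy
      · exact ⟨y, hy, Iio_subset_Iio hxy, subset_rfl⟩
      · exact ⟨x, hx, subset_rfl, Iio_subset_Iio hxy⟩

theorem measure_le_of_forall_Ioi (ν : Measure ℝ) [NullSingletonClass ν] {A : Set ℝ}
    {c : ℝ≥0∞} (h : ∀ x ∈ A, ν (Ioi x) ≤ c) : ν A ≤ c := by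
  have h' : ∀ x ∈ A, ν (Ici x) ≤ c := fun x hx => by
    rw [← measure_congr (Ioi_ae_eq_Ici (μ := ν))]; exact h x hx
  exact measure_le_of_forall_Iic (α := ℝᵒᵈ) ν (A := A) h'

theorem measure_setOf_Iic_le (ν : Measure ℝ) (c : ℝ≥0∞) : ν {x | ν (Iic x) ≤ c} ≤ c :=
  measure_le_of_forall_Iic ν fun _ hx => hx

theorem measure_setOf_Ioi_le (ν : Measure ℝ) [NullSingletonClass ν] (c : ℝ≥0∞) :
    ν {x | ν (Ioi x) ≤ c} ≤ c :=
  measure_le_of_forall_Ioi ν fun _ hx => hx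

theorem monotone_measure_Iic (ν : Measure ℝ) : Monotone fun x => ν (Iic x) :=
  fun _ _ h => measure_mono (Iic_subset_Iic.2 h)

theorem antitone_measure_Ioi (ν : Measure ℝ) : Antitone fun x => ν (Ioi x) :=
  fun _ _ h => measure_mono (Ioi_subset_Ioi h)

theorem measurable_measure_Iic (ν : Measure ℝ) : Measurable fun x => ν (Iic x) :=
  (monotone_measure_Iic ν).measurable

theorem measurable_measure_Ioi (ν : Measure ℝ) : Measurable fun x => ν (Ioi x) :=
  (antitone_measure_Ioi ν).measurable

/-- The distribution function of an atomless measure attains every intermediate level, and the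
sublevel set is a closed half-line. -/
theorem exists_measure_Iic_eq (ν : Measure ℝ) [NullSingletonClass ν] (hfin : ∀ x, ν (Iic x) < ∞)
    {c : ℝ≥0∞} (hc : c ≠ 0) {x₀ : ℝ} (hx₀ : c < ν (Iic x₀)) :
    ∃ t, ν (Iic t) = c ∧ ∀ y, ν (Iic y) ≤ c ↔ y ≤ t := by
  set A : Set ℝ := {y | ν (Iic y) ≤ c} with hA
  have hmono := monotone_measure_Iic ν
  have hbdd : ∀ y ∈ A, y ≤ x₀ := fun y hy => by
    by_contra! h
    exact absurd (hx₀.trans_le (hmono h.le)) (not_lt.2 hy)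
  have hne : A.Nonempty := by
    have := tendsto_measure_iInter_atTop (μ := ν) (s := fun n : ℕ => Iic (-(n : ℝ)))
      (fun _ => measurableSet_Iic.nullMeasurableSet)
      (fun m n hmn => Iic_subset_Iic.2 (by simpa using hmn)) ⟨0, (hfin _).ne⟩
    have h0 : (⋂ n : ℕ, Iic (-(n : ℝ))) = ∅ := by
      ext x
      simp only [mem_iInter, mem_Iic, mem_empty_iff_false, iff_false, not_forall, not_le]
      obtain ⟨n, hn⟩ := exists_nat_gt (-x)
      exact ⟨n, by linarith⟩
    rw [h0, measure_empty] at this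
    obtain ⟨n, hn⟩ := (this.eventually (Iio_mem_nhds (pos_iff_ne_zero.2 hc))).exists
    exact ⟨_, le_of_lt hn⟩
  have hbA : BddAbove A := ⟨x₀, hbdd⟩
  have hle : ν (Iic (sSup A)) ≤ c := by
    rw [← measure_congr (Iio_ae_eq_Iic (μ := ν))]
    refine measure_le_of_forall_Iic ν fun x hx => ?_
    obtain ⟨y, hy, hxy⟩ := exists_lt_of_lt_csSup hne hx
    exact (hmono hxy.le).trans hy
  have hiff : ∀ y, ν (Iic y) ≤ c ↔ y ≤ sSup A :=
    fun y => ⟨fun hy => le_csSup hbA hy, fun hy => (hmono hy).trans hle⟩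
  refine ⟨sSup A, le_antisymm hle ?_, hiff⟩
  have ht := tendsto_measure_iInter_atTop (μ := ν)
      (s := fun n : ℕ => Iic (sSup A + 1 / ((n : ℝ) + 1)))
      (fun _ => measurableSet_Iic.nullMeasurableSet)
      (fun m n hmn => Iic_subset_Iic.2 (by
        have := Nat.one_div_le_one_div (α := ℝ) hmn
        linarith)) ⟨0, (hfin _).ne⟩
  have h0 : (⋂ n : ℕ, Iic (sSup A + 1 / ((n : ℝ) + 1))) = Iic (sSup A) := by
    ext x
    simp only [mem_iInter, mem_Iic]
    refine ⟨fun h => le_of_forall_pos_le_add fun ε hε => ?_, fun h n => ?_⟩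
    · obtain ⟨n, hn⟩ := exists_nat_one_div_lt hε
      linarith [h n]
    · have : (0 : ℝ) < 1 / ((n : ℝ) + 1) := Nat.one_div_pos_of_nat
      linarith
  rw [h0] at ht
  refine ge_of_tendsto' ht fun n => ?_
  have : (0 : ℝ) < 1 / ((n : ℝ) + 1) := Nat.one_div_pos_of_nat
  by_contra! h
  linarith [(hiff _).1 h.le]

/-! ### Dyadic levels of a distribution function -/

/-- The `k`-th dyadic layer of the distribution function of `ν`. -/
def layer (ν : Measure ℝ) (k : ℤ) : Set ℝ := {x | ν (Iic x) ∈ Ioc ((2 : ℝ≥0∞) ^ k) (2 ^ (k + 1))}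

theorem measurableSet_layer (ν : Measure ℝ) (k : ℤ) : MeasurableSet (layer ν k) :=
  measurable_measure_Iic ν measurableSet_Ioc

theorem two_zpow_mono {j k : ℤ} (h : j ≤ k) : (2 : ℝ≥0∞) ^ j ≤ 2 ^ k :=
  ENNReal.zpow_le_of_le (by norm_num) h

theorem two_zpow_succ (k : ℤ) : (2 : ℝ≥0∞) ^ (k + 1) = 2 * 2 ^ k := by
  rw [ENNReal.zpow_add (by norm_num) (by norm_num), zpow_one, mul_comm]

theorem two_zpow_ne_zero (k : ℤ) : (2 : ℝ≥0∞) ^ k ≠ 0 :=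
  (ENNReal.zpow_pos (by norm_num) (by norm_num) k).ne'

theorem two_zpow_ne_top (k : ℤ) : (2 : ℝ≥0∞) ^ k ≠ ∞ :=
  (ENNReal.zpow_lt_top (by norm_num) (by norm_num) k).ne

theorem pairwise_disjoint_layer (ν : Measure ℝ) : Pairwise (Function.onFun Disjoint (layer ν)) := by
  have key : ∀ i j : ℤ, i < j → Disjoint (layer ν i) (layer ν j) := fun i j hij =>
    Set.disjoint_left.2 fun x hi hj =>
      absurd (hj.1.trans_le (hi.2.trans (two_zpow_mono (by omega)))) (lt_irrefl _)
  intro i j hij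
  rcases lt_or_gt_of_ne hij with h | h
  · exact key i j h
  · exact (key j i h).symm

theorem exists_mem_layer (ν : Measure ℝ) {x : ℝ} (h0 : ν (Iic x) ≠ 0) (h1 : ν (Iic x) ≠ ∞) :
    ∃ k, x ∈ layer ν k :=
  ENNReal.exists_mem_Ioc_zpow h0 h1 (by norm_num) (by norm_num)

theorem measure_layer_le (ν : Measure ℝ) (k : ℤ) : ν (layer ν k) ≤ 2 ^ (k + 1) :=
  (measure_mono fun _ hx => hx.2).trans (measure_setOf_Iic_le ν _)

/-- Integrals decompose over the layers of `ν`, up to the set where the distribution function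
vanishes. -/
theorem lintegral_eq_tsum_layer (ν η : Measure ℝ) (hfin : ∀ x, ν (Iic x) < ∞) (f : ℝ → ℝ≥0∞)
    (h0 : ∀ᵐ x ∂η, ν (Iic x) = 0 → f x = 0) :
    ∫⁻ x, f x ∂η = ∑' k, ∫⁻ x in layer ν k, f x ∂η := by
  rw [← lintegral_iUnion (measurableSet_layer ν) (pairwise_disjoint_layer ν),
    ← lintegral_indicator (MeasurableSet.iUnion (measurableSet_layer ν))]
  refine lintegral_congr_ae ?_
  filter_upwards [h0] with x hx
  by_cases h : ν (Iic x) = 0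
  · rw [hx h, eq_comm, indicator_apply_eq_zero]
    exact fun _ => hx h
  · obtain ⟨k, hk⟩ := exists_mem_layer ν h (hfin x).ne
    rw [indicator_of_mem (mem_iUnion.2 ⟨k, hk⟩)]

theorem ae_measure_Iic_ne_zero (ν : Measure ℝ) : ∀ᵐ x ∂ν, ν (Iic x) ≠ 0 := by
  have := measure_setOf_Iic_le ν 0
  rw [ae_iff]
  simpa using this

theorem exists_levels (ν : Measure ℝ) [NullSingletonClass ν] (hfin : ∀ x, ν (Iic x) < ∞) :
    ∃ t : ℤ → ℝ, ∀ k, ∀ x, 2 ^ k < ν (Iic x) →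
      ν (Iic (t k)) = 2 ^ k ∧ ∀ y, ν (Iic y) ≤ 2 ^ k ↔ y ≤ t k := by
  have : ∀ k : ℤ, ∃ t : ℝ, ∀ x, 2 ^ k < ν (Iic x) →
      ν (Iic t) = 2 ^ k ∧ ∀ y, ν (Iic y) ≤ 2 ^ k ↔ y ≤ t := by
    intro k
    by_cases h : ∃ x, 2 ^ k < ν (Iic x)
    · obtain ⟨x, hx⟩ := h
      obtain ⟨t, ht⟩ := exists_measure_Iic_eq ν hfin (two_zpow_ne_zero k) hx
      exact ⟨t, fun _ _ => ht⟩
    · exact ⟨0, fun x hx => absurd ⟨x, hx⟩ h⟩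
  choose t ht using this
  exact ⟨t, ht⟩

/-- The layer just below an attained level has full dyadic mass. -/
theorem measure_layer_pred (ν : Measure ℝ) [NullSingletonClass ν] (hfin : ∀ x, ν (Iic x) < ∞)
    {k : ℤ} {x : ℝ} (hx : 2 ^ k < ν (Iic x)) : ν (layer ν (k - 1)) = 2 ^ (k - 1) := by
  obtain ⟨t, ht⟩ := exists_levels ν hfin
  obtain ⟨h1, h2⟩ := ht k x hx
  obtain ⟨h3, h4⟩ := ht (k - 1) x ((two_zpow_mono (by omega)).trans_lt hx)
  have hE : layer ν (k - 1) = Ioc (t (k - 1)) (t k) := by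
    ext y
    simp only [layer, mem_ofPred_eq, mem_Ioc, ← h2, sub_add_cancel]
    rw [← not_le, h4, not_le]
  have hle : t (k - 1) ≤ t k := by
    rw [← h2, h3]; exact two_zpow_mono (by omega)
  have hd : ν (Iic (t k)) = ν (Iic (t (k - 1))) + ν (Ioc (t (k - 1)) (t k)) := by
    rw [← measure_union (Iic_disjoint_Ioc le_rfl) measurableSet_Ioc, Iic_union_Ioc_eq_Iic hle]
  rw [hE]
  have h5 : (2 : ℝ≥0∞) ^ k = 2 ^ (k - 1) + 2 ^ (k - 1) := by
    rw [← two_mul, ← two_zpow_succ, sub_add_cancel]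
  rw [h1, h3, h5] at hd
  exact ((ENNReal.add_right_inj (two_zpow_ne_top _)).1 hd).symm

/-! ### Elementary inequalities for powers, sums and integrals -/

theorem add_rpow_le_two_rpow_mul (a b : ℝ≥0∞) {q : ℝ} (hq : 0 ≤ q) :
    (a + b) ^ q ≤ 2 ^ q * (a ^ q + b ^ q) := by
  have h : a + b ≤ 2 * max a b := by
    rw [two_mul]; exact add_le_add (le_max_left _ _) (le_max_right _ _)
  refine (ENNReal.rpow_le_rpow h hq).trans ?_
  rw [ENNReal.mul_rpow_of_nonneg _ _ hq]
  gcongr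
  rcases le_total a b with h | h
  · rw [max_eq_right h]; exact le_add_self
  · rw [max_eq_left h]; exact le_self_add

theorem rpow_le_rpow_of_nonpos {x y : ℝ≥0∞} {a : ℝ} (ha : a ≤ 0) (h : x ≤ y) : y ^ a ≤ x ^ a := by
  have := ENNReal.inv_le_inv.2 (ENNReal.rpow_le_rpow h (neg_nonneg.2 ha))
  rwa [ENNReal.rpow_neg, ENNReal.rpow_neg, inv_inv, inv_inv] at this

theorem finset_sum_rpow_le {ι : Type*} (s : Finset ι) (f : ι → ℝ≥0∞) {a : ℝ} (h0 : 0 < a)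
    (h1 : a ≤ 1) : (∑ i ∈ s, f i) ^ a ≤ ∑ i ∈ s, f i ^ a := by
  classical
  induction s using Finset.induction_on with
  | empty => simp [h0]
  | insert i s hi ih =>
    rw [Finset.sum_insert hi, Finset.sum_insert hi]
    exact (ENNReal.rpow_add_le_add_rpow _ _ h0.le h1).trans (by gcongr)

theorem tsum_rpow_le {ι : Type*} (f : ι → ℝ≥0∞) {a : ℝ} (h0 : 0 < a) (h1 : a ≤ 1) :
    (∑' i, f i) ^ a ≤ ∑' i, f i ^ a := by
  rw [← ENNReal.le_rpow_inv_iff h0, ENNReal.tsum_eq_iSup_sum]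
  refine iSup_le fun s => ?_
  rw [ENNReal.le_rpow_inv_iff h0]
  exact (finset_sum_rpow_le s f h0 h1).trans (ENNReal.sum_le_tsum s)

theorem tsum_rpow_le_rpow_tsum {ι : Type*} (f : ι → ℝ≥0∞) {a : ℝ} (h1 : 1 ≤ a) :
    ∑' i, f i ^ a ≤ (∑' i, f i) ^ a := by
  have ha : 0 < a := by linarith
  have := tsum_rpow_le (fun i => f i ^ a) (inv_pos.2 ha) (inv_le_one_of_one_le₀ h1)
  simp only [ENNReal.rpow_rpow_inv ha.ne'] at this
  rwa [ENNReal.rpow_inv_le_iff ha] at this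

theorem tsum_mul_rpow_le (M N : ℤ → ℝ≥0∞) {p q : ℝ} (hq : 0 < q) (hqp : q < p) :
    ∑' k, M k * N k ^ (q / p) ≤
      (∑' k, M k ^ (p / (p - q))) ^ ((p - q) / p) * (∑' k, N k) ^ (q / p) := by
  have hp : 0 < p := hq.trans hqp
  have hpq : 0 < p - q := by linarith
  have hc : (p / (p - q)).HolderConjugate (p / q) := by
    rw [Real.holderConjugate_iff]
    refine ⟨by rw [lt_div_iff₀ hpq]; linarith, by field_simp; ring⟩
  have h := ENNReal.lintegral_mul_le_Lp_mul_Lq (Measure.count : Measure ℤ) hc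
    (f := M) (g := fun k => N k ^ (q / p)) (by fun_prop) (by fun_prop)
  simp only [lintegral_count, Pi.mul_apply, one_div_div, ← ENNReal.rpow_mul] at h
  have h2 : q / p * (p / q) = 1 := by field_simp
  simpa [h2] using h

theorem setLIntegral_le_rpow_mul_rpow (lam : Measure ℝ) {g : ℝ → ℝ≥0∞} (hg : Measurable g) {p : ℝ}
    (hp : 1 < p) (J : Set ℝ) :
    ∫⁻ s in J, g s ∂lam ≤ (∫⁻ s in J, g s ^ p ∂lam) ^ (1 / p) * lam J ^ ((p - 1) / p) := by
  have hc := Real.HolderConjugate.conjExponent hp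
  have h := ENNReal.lintegral_mul_le_Lp_mul_Lq (lam.restrict J) hc
    (f := g) (g := fun _ => 1) hg.aemeasurable (by fun_prop)
  simpa [Real.conjExponent] using h

/-! ### Integrals of powers of a distribution function -/

theorem rpow_succ_le_lintegral (ν : Measure ℝ) {φ : ℝ → ℝ≥0∞} (hφ : Measurable φ)
    (h : ∀ c, ν {x | φ x ≤ c} ≤ c) {s : ℝ} (hs : 0 ≤ s) :
    ν univ ^ (s + 1) ≤ 2 ^ (s + 1) * ∫⁻ x, φ x ^ s ∂ν := by
  have key : ∀ c : ℝ≥0∞, c ^ s * ν {x | φ x ≤ c}ᶜ ≤ ∫⁻ x, φ x ^ s ∂ν := fun c => by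
    rw [← setLIntegral_const]
    refine (setLIntegral_mono (by fun_prop) fun x hx => ?_).trans (setLIntegral_le_lintegral _ _)
    exact ENNReal.rpow_le_rpow (le_of_lt (by simpa using hx)) hs
  have key2 : ∀ c : ℝ≥0∞, ν univ ≤ c + ν {x | φ x ≤ c}ᶜ := fun c =>
    (measure_univ_le_add_compl {x | φ x ≤ c}).trans (by gcongr; exact h c)
  by_cases htop : ν univ = ∞
  · have h1 := key 1
    have h2 := key2 1
    rw [htop, top_le_iff, ENNReal.add_eq_top] at h2
    rcases h2 with h2 | h2
    · simp at h2
    · rw [h2, ENNReal.one_rpow, one_mul, top_le_iff] at h1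
      rw [h1, ENNReal.mul_top (by simp)]
      exact le_top
  · have h3 : ν univ / 2 ≤ ν {x | φ x ≤ ν univ / 2}ᶜ := by
      have := key2 (ν univ / 2)
      nth_rewrite 1 [← ENNReal.add_halves (ν univ)] at this
      exact (ENNReal.add_le_add_iff_left (ENNReal.div_ne_top htop (by norm_num))).1 this
    calc ν univ ^ (s + 1) = 2 ^ (s + 1) * ((ν univ / 2) ^ s * (ν univ / 2)) := by
          rw [← ENNReal.rpow_one (ν univ / 2), ← ENNReal.rpow_mul, one_mul,
            ← ENNReal.rpow_add_of_nonneg _ _ hs zero_le_one,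
            ← ENNReal.mul_rpow_of_nonneg _ _ (by linarith),
            ENNReal.mul_div_cancel (by norm_num) (by norm_num)]
      _ ≤ 2 ^ (s + 1) * ((ν univ / 2) ^ s * ν {x | φ x ≤ ν univ / 2}ᶜ) := by gcongr
      _ ≤ _ := by gcongr; exact key _

theorem rpow_succ_le_setLIntegral_Ioi (ν : Measure ℝ) [NullSingletonClass ν] (E : Set ℝ) {s : ℝ}
    (hs : 0 ≤ s) : ν E ^ (s + 1) ≤ 2 ^ (s + 1) * ∫⁻ x in E, ν (Ioi x) ^ s ∂ν := by
  have := rpow_succ_le_lintegral (ν.restrict E) (measurable_measure_Ioi ν)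
    (fun c => (Measure.restrict_apply_le E _).trans (measure_setOf_Ioi_le ν c)) hs
  simpa using this

theorem rpow_succ_le_setLIntegral_Iic (ν : Measure ℝ) {x : ℝ} (hx : ν (Iic x) ≠ ∞) {a : ℝ}
    (ha : -1 < a) : ν (Iic x) ^ (a + 1) ≤ 2 ^ (a + 1) * ∫⁻ y in Iic x, ν (Iic y) ^ a ∂ν := by
  rcases le_total 0 a with h0 | h0
  · have := rpow_succ_le_lintegral (ν.restrict (Iic x)) (measurable_measure_Iic ν)
      (fun c => (Measure.restrict_apply_le _ _).trans (measure_setOf_Iic_le ν c)) h0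
    simpa using this
  · by_cases hz : ν (Iic x) = 0
    · rw [hz, ENNReal.zero_rpow_of_pos (by linarith)]; exact zero_le
    calc ν (Iic x) ^ (a + 1) = ν (Iic x) ^ a * ν (Iic x) := by
          rw [ENNReal.rpow_add _ _ hz hx, ENNReal.rpow_one]
      _ = ∫⁻ y in Iic x, ν (Iic x) ^ a ∂ν := by rw [setLIntegral_const]
      _ ≤ ∫⁻ y in Iic x, ν (Iic y) ^ a ∂ν :=
          setLIntegral_mono' measurableSet_Iic fun y hy =>
            rpow_le_rpow_of_nonpos h0 (monotone_measure_Iic ν hy)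
      _ ≤ 2 ^ (a + 1) * ∫⁻ y in Iic x, ν (Iic y) ^ a ∂ν :=
          le_mul_of_one_le_left zero_le (ENNReal.one_le_rpow (by norm_num) (by linarith))

theorem exists_setLIntegral_rpow_le {a : ℝ} (ha : -1 < a) : ∃ C : ℝ≥0∞, C ≠ ∞ ∧
    ∀ (ν : Measure ℝ) (x : ℝ), ν (Iic x) ≠ ∞ →
      ∫⁻ y in Iic x, ν (Iic y) ^ a ∂ν ≤ C * ν (Iic x) ^ (a + 1) := by
  rcases le_or_gt 0 a with h0 | h0
  · refine ⟨1, by norm_num, fun ν x _ => ?_⟩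
    rw [one_mul, ENNReal.rpow_add_of_nonneg _ _ h0 zero_le_one, ENNReal.rpow_one,
      ← setLIntegral_const]
    exact setLIntegral_mono' measurableSet_Iic fun y hy =>
      ENNReal.rpow_le_rpow (monotone_measure_Iic ν hy) h0
  · set ρ : ℝ≥0∞ := 2⁻¹ with hρ
    have hρ0 : ρ ≠ 0 := by simp [hρ]
    have hρt : ρ ≠ ∞ := by simp [hρ]
    have hρ1 : ρ < 1 := by simp [hρ]
    refine ⟨ρ ^ a * (1 - ρ ^ (a + 1))⁻¹, ENNReal.mul_ne_top ?_ ?_, fun ν x hM => ?_⟩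
    · exact ENNReal.rpow_ne_top_of_ne_zero hρ0 hρt
    · rw [ENNReal.inv_ne_top, Ne, tsub_eq_zero_iff_le, not_le]
      exact ENNReal.rpow_lt_one hρ1 (by linarith)
    set M := ν (Iic x) with hMdef
    by_cases hM0 : M = 0
    · rw [setLIntegral_measure_zero _ _ hM0]; exact zero_le
    let A : ℕ → Set ℝ := fun n => {y | ν (Iic y) ∈ Ioc (M * ρ ^ (n + 1)) (M * ρ ^ n)}
    have hcov : ∀ y, y ≤ x → ν (Iic y) ≠ 0 → y ∈ ⋃ n, A n := by
      intro y hy hy0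
      have hex : ∃ n : ℕ, M * ρ ^ (n + 1) < ν (Iic y) := by
        have ht : Filter.Tendsto (fun n : ℕ => M * ρ ^ (n + 1)) Filter.atTop (nhds (M * 0)) :=
          ENNReal.Tendsto.const_mul
            ((ENNReal.tendsto_pow_atTop_nhds_zero_of_lt_one hρ1).comp
              (Filter.tendsto_add_atTop_nat 1)) (Or.inr hM)
        rw [mul_zero] at ht
        exact (ht.eventually (Iio_mem_nhds (pos_iff_ne_zero.2 hy0))).exists
      classical
      refine mem_iUnion.2 ⟨Nat.find hex, Nat.find_spec hex, ?_⟩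
      rcases Nat.eq_zero_or_pos (Nat.find hex) with h | h
      · rw [h, pow_zero, mul_one]; exact monotone_measure_Iic ν hy
      · have := Nat.find_min hex (Nat.sub_lt h one_pos)
        rwa [show Nat.find hex - 1 + 1 = Nat.find hex by omega, not_lt] at this
    calc ∫⁻ y in Iic x, ν (Iic y) ^ a ∂ν ≤ ∫⁻ y in ⋃ n, A n, ν (Iic y) ^ a ∂ν := by
          refine lintegral_mono' (Measure.restrict_mono_ae ?_) le_rfl
          filter_upwards [ae_measure_Iic_ne_zero ν] with y hy hyx using hcov y hyx hy
      _ ≤ ∑' n, ∫⁻ y in A n, ν (Iic y) ^ a ∂ν := lintegral_iUnion_le _ _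
      _ ≤ ∑' n : ℕ, ρ ^ a * M ^ (a + 1) * (ρ ^ (a + 1)) ^ n := by
          refine ENNReal.tsum_le_tsum fun n => ?_
          calc ∫⁻ y in A n, ν (Iic y) ^ a ∂ν ≤ ∫⁻ y in A n, (M * ρ ^ (n + 1)) ^ a ∂ν :=
                setLIntegral_mono measurable_const fun y hy =>
                  rpow_le_rpow_of_nonpos h0.le hy.1.le
            _ = (M * ρ ^ (n + 1)) ^ a * ν (A n) := by rw [setLIntegral_const]
            _ ≤ (M * ρ ^ (n + 1)) ^ a * (M * ρ ^ n) := by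
                gcongr
                exact (measure_mono fun y hy => hy.2).trans (measure_setOf_Iic_le ν _)
            _ = _ := by
                have e1 : (M * ρ ^ (n + 1)) ^ a = M ^ a * (ρ ^ a * (ρ ^ a) ^ n) := by
                  rw [ENNReal.mul_rpow_of_ne_top hM (ENNReal.pow_ne_top hρt),
                    ← ENNReal.rpow_natCast, ← ENNReal.rpow_mul, mul_comm _ a, ENNReal.rpow_mul,
                    ENNReal.rpow_natCast, pow_succ, mul_comm ((ρ ^ a) ^ n)]
                rw [e1, ENNReal.rpow_add _ _ hM0 hM, ENNReal.rpow_add _ _ hρ0 hρt,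
                  ENNReal.rpow_one, ENNReal.rpow_one, mul_pow]
                ring
      _ = _ := by
          rw [ENNReal.tsum_mul_left, ENNReal.tsum_geometric]; ring

/-! ### Two Hardy inequalities -/

theorem withDensity_Iic (lam : Measure ℝ) (g : ℝ → ℝ≥0∞) (x : ℝ) :
    lam.withDensity g (Iic x) = ∫⁻ s in Iic x, g s ∂lam :=
  withDensity_apply _ measurableSet_Iic

theorem withDensity_Iic_lt_top {lam : Measure ℝ} {g : ℝ → ℝ≥0∞} (hg : Measurable g) {p : ℝ}
    (hp : 1 < p) (hV : ∀ x, lam (Iic x) < ∞) (hN : ∫⁻ s, g s ^ p ∂lam ≠ ∞) (x : ℝ) :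
    lam.withDensity g (Iic x) < ∞ := by
  rw [withDensity_Iic]
  refine (setLIntegral_le_rpow_mul_rpow lam hg hp _).trans_lt (ENNReal.mul_lt_top ?_ ?_)
  · exact ENNReal.rpow_lt_top_of_nonneg (by positivity)
      ((setLIntegral_le_lintegral _ _).trans_lt hN.lt_top).ne
  · exact ENNReal.rpow_lt_top_of_nonneg (div_nonneg (by linarith) (by linarith)) (hV x).ne

/-- On each dyadic layer of the primitive of `g`, the primitive is controlled by a piece of the
`L^p` norm of `g`, the pieces being disjoint. -/
theorem exists_layer_bound (lam : Measure ℝ) [NullSingletonClass lam] {g : ℝ → ℝ≥0∞}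
    (hg : Measurable g) {p : ℝ} (hp : 1 < p) (hV : ∀ x, lam (Iic x) < ∞)
    (hN : ∫⁻ s, g s ^ p ∂lam ≠ ∞) :
    ∃ (t : ℤ → ℝ) (N : ℤ → ℝ≥0∞), ∑' k, N k ≤ ∫⁻ s, g s ^ p ∂lam ∧
      ∀ k, ∀ x ∈ layer (lam.withDensity g) k, t k < x ∧ lam.withDensity g (Iic (t k)) ≠ 0 ∧
        lam.withDensity g (Iic x) ≤ 4 * (N k ^ (1 / p) * lam (Iic (t k)) ^ ((p - 1) / p)) := by
  set ν := lam.withDensity g with hν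
  have hfin : ∀ x, ν (Iic x) < ∞ := withDensity_Iic_lt_top hg hp hV hN
  have : NullSingletonClass ν := by infer_instance
  obtain ⟨t, ht⟩ := exists_levels ν hfin
  refine ⟨t, fun k => ∫⁻ s in layer ν (k - 1), g s ^ p ∂lam, ?_, fun k x hx => ?_⟩
  · refine ((Equiv.subRight (1 : ℤ)).tsum_eq (fun k => ∫⁻ s in layer ν k, g s ^ p ∂lam)).trans_le ?_
    rw [← lintegral_iUnion (measurableSet_layer ν) (pairwise_disjoint_layer ν)]
    exact setLIntegral_le_lintegral _ _
  · obtain ⟨h1, h2⟩ := ht k x hx.1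
    refine ⟨?_, by rw [h1]; exact two_zpow_ne_zero k, ?_⟩
    · rw [← not_le, ← h2, not_le]; exact hx.1
    · have hsub : layer ν (k - 1) ⊆ Iic (t k) := fun y hy => by
        rw [mem_Iic, ← h2]
        have := hy.2
        rwa [sub_add_cancel] at this
      have h3 := measure_layer_pred ν hfin hx.1
      have h4 : ν (layer ν (k - 1)) = ∫⁻ s in layer ν (k - 1), g s ∂lam :=
        withDensity_apply _ (measurableSet_layer _ _)
      calc ν (Iic x) ≤ 2 ^ (k + 1) := hx.2
        _ = 4 * 2 ^ (k - 1) := by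
            rw [show k + 1 = k - 1 + 1 + 1 by ring, two_zpow_succ, two_zpow_succ, ← mul_assoc]
            norm_num
        _ = 4 * ∫⁻ s in layer ν (k - 1), g s ∂lam := by rw [← h4, h3]
        _ ≤ _ := by
            gcongr
            refine (setLIntegral_le_rpow_mul_rpow lam hg hp _).trans ?_
            gcongr

theorem lintegral_rpow_le_of_le (lam υ : Measure ℝ) [NullSingletonClass lam] {g : ℝ → ℝ≥0∞}
    (hg : Measurable g) {p r : ℝ} (hp : 1 < p) (hpr : p ≤ r) (hV : ∀ x, lam (Iic x) < ∞)
    (hN : ∫⁻ s, g s ^ p ∂lam ≠ ∞) {B : ℝ≥0∞}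
    (hB : ∀ t, lam.withDensity g (Iic t) ≠ 0 →
      υ (Ioi t) ^ (1 / r) * lam (Iic t) ^ ((p - 1) / p) ≤ B) :
    ∫⁻ x, lam.withDensity g (Iic x) ^ r ∂υ ≤ (4 * B) ^ r * (∫⁻ s, g s ^ p ∂lam) ^ (r / p) := by
  have hr : 0 < r := by linarith
  have hp0 : 0 < p := by linarith
  obtain ⟨t, N, hsum, h⟩ := exists_layer_bound lam hg hp hV hN
  set ν := lam.withDensity g with hν
  have hfin : ∀ x, ν (Iic x) < ∞ := withDensity_Iic_lt_top hg hp hV hN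
  rw [lintegral_eq_tsum_layer ν υ hfin _ (ae_of_all _ fun x hx => by simp [hx, hr])]
  calc ∑' k, ∫⁻ x in layer ν k, ν (Iic x) ^ r ∂υ ≤ ∑' k, (4 * B) ^ r * N k ^ (r / p) := by
        refine ENNReal.tsum_le_tsum fun k => ?_
        rcases (layer ν k).eq_empty_or_nonempty with he | ⟨x₀, hx₀⟩
        · rw [he]; simp
        have hsub : layer ν k ⊆ Ioi (t k) := fun x hx => (h k x hx).1
        calc ∫⁻ x in layer ν k, ν (Iic x) ^ r ∂υ
            ≤ ∫⁻ x in layer ν k, (4 * (N k ^ (1 / p) * lam (Iic (t k)) ^ ((p - 1) / p))) ^ r ∂υ :=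
              setLIntegral_mono measurable_const fun x hx =>
                ENNReal.rpow_le_rpow (h k x hx).2.2 hr.le
          _ = (4 * (N k ^ (1 / p) * lam (Iic (t k)) ^ ((p - 1) / p))) ^ r * υ (layer ν k) :=
              setLIntegral_const _ _
          _ ≤ (4 * (N k ^ (1 / p) * lam (Iic (t k)) ^ ((p - 1) / p))) ^ r * υ (Ioi (t k)) := by
              gcongr
          _ = (4 * (υ (Ioi (t k)) ^ (1 / r) * lam (Iic (t k)) ^ ((p - 1) / p))) ^ r
                * N k ^ (r / p) := by
              have e1 : N k ^ (r / p) = (N k ^ (1 / p)) ^ r := by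
                rw [← ENNReal.rpow_mul]; congr 1; ring
              have e2 : υ (Ioi (t k)) = (υ (Ioi (t k)) ^ (1 / r)) ^ r := by
                rw [← ENNReal.rpow_mul, one_div_mul_cancel hr.ne', ENNReal.rpow_one]
              rw [e1]
              conv_lhs => rw [e2]
              rw [← ENNReal.mul_rpow_of_nonneg _ _ hr.le, ← ENNReal.mul_rpow_of_nonneg _ _ hr.le]
              congr 1; ring
          _ ≤ (4 * B) ^ r * N k ^ (r / p) := by
              gcongr
              exact hB _ (h k x₀ hx₀).2.1
    _ ≤ (4 * B) ^ r * (∑' k, N k) ^ (r / p) := by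
        rw [ENNReal.tsum_mul_left]
        gcongr
        exact tsum_rpow_le_rpow_tsum _ ((one_le_div hp0).2 hpr)
    _ ≤ _ := by gcongr

theorem lintegral_rpow_le_of_lt (lam κ : Measure ℝ) [NullSingletonClass lam]
    [NullSingletonClass κ] {g : ℝ → ℝ≥0∞}
    (hg : Measurable g) {p q : ℝ} (hp : 1 < p) (hq : 0 < q) (hqp : q < p)
    (hV : ∀ x, lam (Iic x) < ∞) (hN : ∫⁻ s, g s ^ p ∂lam ≠ ∞) :
    ∫⁻ x, lam.withDensity g (Iic x) ^ q ∂κ ≤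
      4 ^ q * 2 * (∫⁻ x, κ (Ioi x) ^ (q / (p - q)) * lam (Iic x) ^ ((p - 1) * q / (p - q)) ∂κ) ^
        ((p - q) / p) * (∫⁻ s, g s ^ p ∂lam) ^ (q / p) := by
  have hp0 : 0 < p := by linarith
  have hpq : 0 < p - q := by linarith
  have hp1 : 0 < p - 1 := by linarith
  obtain ⟨t, N, hsum, h⟩ := exists_layer_bound lam hg hp hV hN
  set ν := lam.withDensity g with hν
  have hfin : ∀ x, ν (Iic x) < ∞ := withDensity_Iic_lt_top hg hp hV hN
  rw [lintegral_eq_tsum_layer ν κ hfin _ (ae_of_all _ fun x hx => by simp [hx, hq])]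
  set M : ℤ → ℝ≥0∞ := fun k => lam (Iic (t k)) ^ ((p - 1) * q / p) * κ (layer ν k) with hM
  set f : ℝ → ℝ≥0∞ := fun x => κ (Ioi x) ^ (q / (p - q)) * lam (Iic x) ^ ((p - 1) * q / (p - q))
    with hf
  have hMk : ∀ k, M k ^ (p / (p - q)) ≤ 2 ^ (p / (p - q)) * ∫⁻ x in layer ν k, f x ∂κ := by
    intro k
    have e1 : q / (p - q) + 1 = p / (p - q) := by field_simp; ring
    have e2 : (p - 1) * q / p * (p / (p - q)) = (p - 1) * q / (p - q) := by field_simp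
    rw [hM, ENNReal.mul_rpow_of_nonneg _ _ (by positivity), ← ENNReal.rpow_mul, e2]
    calc lam (Iic (t k)) ^ ((p - 1) * q / (p - q)) * κ (layer ν k) ^ (p / (p - q))
        ≤ lam (Iic (t k)) ^ ((p - 1) * q / (p - q)) *
            (2 ^ (p / (p - q)) * ∫⁻ x in layer ν k, κ (Ioi x) ^ (q / (p - q)) ∂κ) := by
          gcongr
          rw [← e1]
          exact rpow_succ_le_setLIntegral_Ioi κ _ (by positivity)
      _ = 2 ^ (p / (p - q)) * ∫⁻ x in layer ν k,
            κ (Ioi x) ^ (q / (p - q)) * lam (Iic (t k)) ^ ((p - 1) * q / (p - q)) ∂κ := by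
          rw [lintegral_mul_const _ ((measurable_measure_Ioi κ).pow_const _)]; ring
      _ ≤ _ := by
          gcongr 2 ^ (p / (p - q)) * ?_
          refine setLIntegral_mono' (measurableSet_layer _ _) fun x hx => ?_
          simp only [hf]
          gcongr
          exact (h k x hx).1.le
  calc ∑' k, ∫⁻ x in layer ν k, ν (Iic x) ^ q ∂κ ≤ ∑' k, 4 ^ q * (M k * N k ^ (q / p)) := by
        refine ENNReal.tsum_le_tsum fun k => ?_
        calc ∫⁻ x in layer ν k, ν (Iic x) ^ q ∂κ
            ≤ ∫⁻ x in layer ν k, (4 * (N k ^ (1 / p) * lam (Iic (t k)) ^ ((p - 1) / p))) ^ q ∂κ :=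
              setLIntegral_mono measurable_const fun x hx =>
                ENNReal.rpow_le_rpow (h k x hx).2.2 hq.le
          _ = (4 * (N k ^ (1 / p) * lam (Iic (t k)) ^ ((p - 1) / p))) ^ q * κ (layer ν k) :=
              setLIntegral_const _ _
          _ = _ := by
              rw [ENNReal.mul_rpow_of_nonneg _ _ hq.le, ENNReal.mul_rpow_of_nonneg _ _ hq.le,
                ← ENNReal.rpow_mul, ← ENNReal.rpow_mul, one_div_mul_eq_div, div_mul_eq_mul_div, hM]
              ring
    _ ≤ 4 ^ q * ((∑' k, M k ^ (p / (p - q))) ^ ((p - q) / p) * (∑' k, N k) ^ (q / p)) := by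
        rw [ENNReal.tsum_mul_left]
        gcongr
        exact tsum_mul_rpow_le M N hq hqp
    _ ≤ 4 ^ q * ((2 ^ (p / (p - q)) * ∫⁻ x, f x ∂κ) ^ ((p - q) / p) *
          (∫⁻ s, g s ^ p ∂lam) ^ (q / p)) := by
        gcongr
        refine (ENNReal.tsum_le_tsum hMk).trans ?_
        rw [ENNReal.tsum_mul_left,
          ← lintegral_iUnion (measurableSet_layer ν) (pairwise_disjoint_layer ν)]
        gcongr
        exact Measure.restrict_le_self
    _ = _ := by
        rw [ENNReal.mul_rpow_of_nonneg _ _ (by positivity), ← ENNReal.rpow_mul,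
          div_mul_div_cancel₀ hpq.ne', div_self hp0.ne', ENNReal.rpow_one]
        ring

/-! ### Sufficiency -/

/-- The monotone envelope of `t ↦ υ (Ioi t) ^ (1 / r) * lam (Iic t) ^ ((p - 1) / p)`. -/
def envelope (lam υ : Measure ℝ) (p r x : ℝ) : ℝ≥0∞ :=
  ⨆ t ∈ Ici x, υ (Ioi t) ^ (1 / r) * lam (Iic t) ^ ((p - 1) / p)

theorem le_envelope (lam υ : Measure ℝ) (p r : ℝ) {x t : ℝ} (h : x ≤ t) :
    υ (Ioi t) ^ (1 / r) * lam (Iic t) ^ ((p - 1) / p) ≤ envelope lam υ p r x :=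
  le_iSup₂ (f := fun t (_ : t ∈ Ici x) => υ (Ioi t) ^ (1 / r) * lam (Iic t) ^ ((p - 1) / p)) t h

theorem antitone_envelope (lam υ : Measure ℝ) (p r : ℝ) : Antitone (envelope lam υ p r) :=
  fun _ _ h => iSup₂_le fun _ ht => le_envelope lam υ p r (h.trans ht)

theorem tsum_two_zpow_le (j : ℤ) :
    ∑' k : ℤ, (if k ≤ j then (2 : ℝ≥0∞) ^ (k + 1) else 0) ≤ 4 * 2 ^ j := by
  have hinj : Function.Injective fun n : ℕ => j - (n : ℤ) := fun m n h => by simpa using h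
  have hsup : Function.support (fun k : ℤ => if k ≤ j then (2 : ℝ≥0∞) ^ (k + 1) else 0) ⊆
      range fun n : ℕ => j - (n : ℤ) := by
    intro k hk
    have hkj : k ≤ j := by
      by_contra h
      simp [h] at hk
    exact ⟨(j - k).toNat, by simp only; omega⟩
  rw [← hinj.tsum_eq hsup]
  have e : ∀ n : ℕ, (if j - (n : ℤ) ≤ j then (2 : ℝ≥0∞) ^ (j - (n : ℤ) + 1) else 0) =
      2 ^ (j + 1) * 2⁻¹ ^ n := fun n => by
    rw [if_pos (by omega), show j - (n : ℤ) + 1 = j + 1 + -(n : ℤ) by ring,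
      ENNReal.zpow_add (by norm_num) (by norm_num) (j + 1), ENNReal.zpow_neg, zpow_natCast,
      ENNReal.inv_pow]
  simp_rw [e]
  rw [ENNReal.tsum_mul_left, ENNReal.tsum_geometric, ENNReal.one_sub_inv_two, inv_inv,
    two_zpow_succ]
  apply le_of_eq
  ring

/-- Discretization of an iterated integral along the layers of the outer measure. -/
theorem lintegral_rpow_tail_le_tsum (υ η : Measure ℝ) (hW : ∀ x, η (Iic x) < ∞)
    (f : ℝ → ℝ≥0∞) {a : ℝ} (h0 : 0 < a) (h1 : a ≤ 1) :
    ∫⁻ x, (∫⁻ y in Ioi x, f y ∂υ) ^ a ∂η ≤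
      ∑' j, 4 * 2 ^ j * (∫⁻ y in layer η j, f y ∂υ) ^ a := by
  rw [lintegral_eq_tsum_layer η η hW _
    ((ae_measure_Iic_ne_zero η).mono fun x hx h => absurd h hx)]
  set b : ℤ → ℝ≥0∞ := fun j => ∫⁻ y in layer η j, f y ∂υ with hb
  have key : ∀ k, ∀ x ∈ layer η k, ∫⁻ y in Ioi x, f y ∂υ ≤ ∑' j, if k ≤ j then b j else 0 := by
    intro k x hx
    have hcov : Ioi x ⊆ ⋃ j : ℤ, (if k ≤ j then layer η j else ∅) := by
      intro y hy
      have hxy : 2 ^ k < η (Iic y) := hx.1.trans_le (monotone_measure_Iic η (le_of_lt hy))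
      obtain ⟨j, hj⟩ := exists_mem_layer η (ne_of_gt (zero_le.trans_lt hxy)) (hW y).ne
      refine mem_iUnion.2 ⟨j, ?_⟩
      have hkj : k ≤ j := by
        by_contra! h
        exact absurd (hxy.trans_le (hj.2.trans (two_zpow_mono (by omega)))) (lt_irrefl _)
      rwa [if_pos hkj]
    refine (lintegral_mono_set hcov).trans ((lintegral_iUnion_le _ _).trans (le_of_eq ?_))
    refine tsum_congr fun j => ?_
    split_ifs <;> simp [hb]
  calc ∑' k, ∫⁻ x in layer η k, (∫⁻ y in Ioi x, f y ∂υ) ^ a ∂η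
      ≤ ∑' k, ∑' j, (if k ≤ j then (2 : ℝ≥0∞) ^ (k + 1) else 0) * b j ^ a := by
        refine ENNReal.tsum_le_tsum fun k => ?_
        calc ∫⁻ x in layer η k, (∫⁻ y in Ioi x, f y ∂υ) ^ a ∂η
            ≤ ∫⁻ x in layer η k, (∑' j, if k ≤ j then b j else 0) ^ a ∂η :=
              setLIntegral_mono measurable_const fun x hx =>
                ENNReal.rpow_le_rpow (key k x hx) h0.le
          _ = (∑' j, if k ≤ j then b j else 0) ^ a * η (layer η k) := setLIntegral_const _ _
          _ ≤ (∑' j, (if k ≤ j then b j else 0) ^ a) * 2 ^ (k + 1) :=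
              mul_le_mul' (tsum_rpow_le _ h0 h1) (measure_layer_le η k)
          _ = _ := by
              rw [← ENNReal.tsum_mul_right]
              refine tsum_congr fun j => ?_
              split_ifs
              · rw [mul_comm]
              · simp [h0]
    _ = ∑' j, ∑' k, (if k ≤ j then (2 : ℝ≥0∞) ^ (k + 1) else 0) * b j ^ a := ENNReal.tsum_comm
    _ ≤ _ := by
        refine ENNReal.tsum_le_tsum fun j => ?_
        rw [ENNReal.tsum_mul_right]
        gcongr
        exact tsum_two_zpow_le j

theorem rpow_setLIntegral_layer_le (lam υ η : Measure ℝ) [NullSingletonClass lam]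
    {g : ℝ → ℝ≥0∞} (hg : Measurable g) {p q r : ℝ} (hp : 1 < p) (hq : 0 < q) (hqp : q < p)
    (hpr : p ≤ r) (hV : ∀ x, lam (Iic x) < ∞) (hN : ∫⁻ s, g s ^ p ∂lam ≠ ∞) {j : ℤ} {z : ℝ}
    (hz : ∀ y, η (Iic y) ≤ 2 ^ j ↔ y ≤ z) :
    (∫⁻ y in layer η j, lam.withDensity g (Iic y) ^ r ∂υ) ^ (q / r) ≤
      2 ^ q * (lam.withDensity g (Iic z) ^ q * υ (Ioi z) ^ (q / r) +
        4 ^ q * (envelope lam υ p r z ^ q * (∫⁻ s in layer η j, g s ^ p ∂lam) ^ (q / p))) := by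
  have hr : 0 < r := by linarith
  have hp0 : 0 < p := by linarith
  set ν := lam.withDensity g with hν
  set E := layer η j with hE
  have hEm : MeasurableSet E := measurableSet_layer η j
  have hνE : lam.withDensity (E.indicator g) = ν.restrict E := by
    rw [withDensity_indicator hEm, hν, restrict_withDensity hEm]
  have hEz : E ⊆ Ioi z := fun y hy => by
    rw [mem_Ioi, ← not_le, ← hz, not_le]; exact hy.1
  have hpow : ∫⁻ s, E.indicator g s ^ p ∂lam = ∫⁻ s in E, g s ^ p ∂lam := by
    rw [← lintegral_indicator hEm]
    congr 1 with s
    by_cases hs : s ∈ E <;> simp [hs, hp0]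
  have hardy := lintegral_rpow_le_of_le lam υ (hg.indicator hEm) hp hpr hV
    (by rw [hpow]; exact ((setLIntegral_le_lintegral _ _).trans_lt hN.lt_top).ne)
    (B := envelope lam υ p r z) (by
      intro t ht
      refine le_envelope lam υ p r ?_
      by_contra! htz
      refine ht ?_
      rw [hνE, Measure.restrict_apply measurableSet_Iic]
      have : Iic t ∩ E = ∅ := by
        ext y
        simp only [mem_inter_iff, mem_Iic, mem_empty_iff_false, iff_false, not_and]
        intro hy hyE
        have : z < y := hEz hyE
        linarith
      rw [this, measure_empty])
  rw [hνE, hpow] at hardy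
  have hsplit : ∀ y ∈ E, ν (Iic y) ≤ ν (Iic z) + ν.restrict E (Iic y) := by
    intro y hy
    rw [Measure.restrict_apply measurableSet_Iic]
    refine (measure_mono fun s hs => ?_).trans (measure_union_le _ _)
    rcases le_or_gt s z with h | h
    · exact Or.inl h
    · refine Or.inr ⟨hs, ?_, (monotone_measure_Iic η hs).trans hy.2⟩
      rw [← not_le, hz, not_le]; exact h
  have hb : ∫⁻ y in E, ν (Iic y) ^ r ∂υ ≤ 2 ^ r * (ν (Iic z) ^ r * υ (Ioi z) +
      (4 * envelope lam υ p r z) ^ r * (∫⁻ s in E, g s ^ p ∂lam) ^ (r / p)) := by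
    calc ∫⁻ y in E, ν (Iic y) ^ r ∂υ
        ≤ ∫⁻ y in E, 2 ^ r * (ν (Iic z) ^ r + ν.restrict E (Iic y) ^ r) ∂υ :=
          setLIntegral_mono' hEm fun y hy =>
            (ENNReal.rpow_le_rpow (hsplit y hy) hr.le).trans (add_rpow_le_two_rpow_mul _ _ hr.le)
      _ = 2 ^ r * (ν (Iic z) ^ r * υ E + ∫⁻ y in E, ν.restrict E (Iic y) ^ r ∂υ) := by
          rw [lintegral_const_mul' _ _ (ENNReal.rpow_ne_top_of_nonneg hr.le (by norm_num)),
            lintegral_add_left measurable_const, setLIntegral_const]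
      _ ≤ _ := by
          gcongr
          exact (setLIntegral_le_lintegral _ _).trans hardy
  have hqr : 0 < q / r := by positivity
  have hqr' : r * (q / r) = q := by field_simp
  refine (ENNReal.rpow_le_rpow hb hqr.le).trans ?_
  rw [ENNReal.mul_rpow_of_nonneg _ _ hqr.le, ← ENNReal.rpow_mul, hqr']
  gcongr
  refine (ENNReal.rpow_add_le_add_rpow _ _ hqr.le ?_).trans (le_of_eq ?_)
  · rw [div_le_one hr]; linarith
  · rw [ENNReal.mul_rpow_of_nonneg _ _ hqr.le, ENNReal.mul_rpow_of_nonneg _ _ hqr.le,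
      ← ENNReal.rpow_mul, ← ENNReal.rpow_mul, ← ENNReal.rpow_mul, hqr',
      ENNReal.mul_rpow_of_nonneg _ _ hq.le, mul_assoc]
    congr 4
    field_simp

theorem rpow_mul_measure_layer_le (lam υ η : Measure ℝ) {g : ℝ → ℝ≥0∞} (hg : Measurable g)
    {p q r : ℝ} (hp : 1 < p) (hq : 0 < q) (hpr : p ≤ r) {j : ℤ} {z : ℝ}
    (hzj : ∀ y, η (Iic y) ≤ 2 ^ j ↔ y ≤ z)
    (hmass : η (layer η (j - 1)) = 2 ^ (j - 1)) :
    2 ^ j * (lam.withDensity g (Iic z) ^ q * υ (Ioi z) ^ (q / r)) ≤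
      2 ^ q * (2 * (∫⁻ x in layer η (j - 1),
          lam.withDensity g (Iic x) ^ q * υ (Ioi x) ^ (q / r) ∂η) +
        2 ^ j * envelope lam υ p r z ^ q *
          (∫⁻ s in layer η (j - 1), g s ^ p ∂lam) ^ (q / p)) := by
  have hr : 0 < r := by linarith
  have hp0 : 0 < p := by linarith
  set ν := lam.withDensity g with hν
  set E := layer η (j - 1) with hE
  have hEm : MeasurableSet E := measurableSet_layer η (j - 1)
  have hEz : ∀ x ∈ E, x ≤ z := fun x hx => by
    rw [← hzj]; have := hx.2; rwa [sub_add_cancel] at this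
  set S := envelope lam υ p r z with hS
  set N := ∫⁻ s in E, g s ^ p ∂lam with hNdef
  have hsplit : ∀ x ∈ E, ν (Iic z) ≤ ν (Iic x) + N ^ (1 / p) * lam (Iic z) ^ ((p - 1) / p) := by
    intro x hx
    have h1 : ν (Iic z) ≤ ν (Iic x) + ν E := by
      refine (measure_mono fun s hs => ?_).trans (measure_union_le _ _)
      rcases le_or_gt s x with h | h
      · exact Or.inl h
      · refine Or.inr ⟨hx.1.trans_le (monotone_measure_Iic η h.le), ?_⟩
        rw [sub_add_cancel, hzj]; exact hs
    refine h1.trans (by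
      gcongr
      rw [hν, withDensity_apply _ hEm]
      refine (setLIntegral_le_rpow_mul_rpow lam hg hp _).trans ?_
      gcongr
      exact hEz)
  have hpt : ∀ x ∈ E, ν (Iic z) ^ q * υ (Ioi z) ^ (q / r) ≤
      2 ^ q * (ν (Iic x) ^ q * υ (Ioi x) ^ (q / r) + S ^ q * N ^ (q / p)) := by
    intro x hx
    have e : ∀ y, υ (Ioi y) ^ (q / r) = (υ (Ioi y) ^ (1 / r)) ^ q := fun y => by
      rw [← ENNReal.rpow_mul, one_div_mul_eq_div]
    have e2 : N ^ (q / p) = (N ^ (1 / p)) ^ q := by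
      rw [← ENNReal.rpow_mul, one_div_mul_eq_div]
    rw [e, e, e2, ← ENNReal.mul_rpow_of_nonneg _ _ hq.le, ← ENNReal.mul_rpow_of_nonneg _ _ hq.le,
      ← ENNReal.mul_rpow_of_nonneg _ _ hq.le]
    refine (ENNReal.rpow_le_rpow ?_ hq.le).trans (add_rpow_le_two_rpow_mul _ _ hq.le)
    calc ν (Iic z) * υ (Ioi z) ^ (1 / r)
        ≤ (ν (Iic x) + N ^ (1 / p) * lam (Iic z) ^ ((p - 1) / p)) * υ (Ioi z) ^ (1 / r) := by
          gcongr; exact hsplit x hx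
      _ = ν (Iic x) * υ (Ioi z) ^ (1 / r) +
            υ (Ioi z) ^ (1 / r) * lam (Iic z) ^ ((p - 1) / p) * N ^ (1 / p) := by ring
      _ ≤ _ := by
          gcongr
          · exact hEz x hx
          · exact le_envelope lam υ p r le_rfl
  have h2j : (2 : ℝ≥0∞) ^ j = 2 * 2 ^ (j - 1) := by rw [← two_zpow_succ, sub_add_cancel]
  calc 2 ^ j * (ν (Iic z) ^ q * υ (Ioi z) ^ (q / r))
      = 2 * ∫⁻ _ in E, ν (Iic z) ^ q * υ (Ioi z) ^ (q / r) ∂η := by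
        rw [setLIntegral_const, hmass, h2j]; ring
    _ ≤ 2 * ∫⁻ x in E, 2 ^ q * (ν (Iic x) ^ q * υ (Ioi x) ^ (q / r) + S ^ q * N ^ (q / p)) ∂η := by
        gcongr 2 * ?_
        exact setLIntegral_mono' hEm hpt
    _ = _ := by
        rw [lintegral_const_mul' _ _ (ENNReal.rpow_ne_top_of_nonneg hq.le (by norm_num)),
          lintegral_add_right _ measurable_const, setLIntegral_const, hmass, h2j]
        ring

/-- The functional governing the `L^q`-Hardy inequality with respect to `κ`. -/
def lowerHardy (lam κ : Measure ℝ) (p q : ℝ) : ℝ≥0∞ :=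
  ∫⁻ x, κ (Ioi x) ^ (q / (p - q)) * lam (Iic x) ^ ((p - 1) * q / (p - q)) ∂κ

/-- The functional built from the envelope. -/
def envelopeEnergy (lam υ η : Measure ℝ) (p q r : ℝ) : ℝ≥0∞ :=
  ∫⁻ x, envelope lam υ p r x ^ (p * q / (p - q)) * η (Iic x) ^ (q / (p - q)) ∂η

theorem rpow_le_setLIntegral_layer (η : Measure ℝ) {E : ℝ → ℝ≥0∞} (hE : Antitone E) {p q : ℝ}
    (hq : 0 < q) (hqp : q < p) {j : ℤ} {z : ℝ} (hz : ∀ y, η (Iic y) ≤ 2 ^ j ↔ y ≤ z)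
    (hmass : η (layer η (j - 1)) = 2 ^ (j - 1)) :
    (2 ^ j * E z ^ q) ^ (p / (p - q)) ≤ 2 ^ (p / (p - q)) *
      ∫⁻ x in layer η (j - 1), E x ^ (p * q / (p - q)) * η (Iic x) ^ (q / (p - q)) ∂η := by
  have hpq : 0 < p - q := by linarith
  have hp0 : 0 < p := by linarith
  have hs : 0 ≤ p / (p - q) := by positivity
  have e1 : p / (p - q) = q / (p - q) + 1 := by field_simp; ring
  have e2 : q * (p / (p - q)) = p * q / (p - q) := by field_simp
  have h2j : (2 : ℝ≥0∞) ^ j = 2 * 2 ^ (j - 1) := by rw [← two_zpow_succ, sub_add_cancel]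
  rw [ENNReal.mul_rpow_of_nonneg _ _ hs, h2j, ENNReal.mul_rpow_of_nonneg _ _ hs,
    ← ENNReal.rpow_mul, e2, mul_assoc]
  gcongr 2 ^ (p / (p - q)) * ?_
  calc ((2 : ℝ≥0∞) ^ (j - 1)) ^ (p / (p - q)) * E z ^ (p * q / (p - q))
      = ∫⁻ x in layer η (j - 1), E z ^ (p * q / (p - q)) *
          ((2 : ℝ≥0∞) ^ (j - 1)) ^ (q / (p - q)) ∂η := by
        rw [setLIntegral_const, hmass, e1, ENNReal.rpow_add _ _ (two_zpow_ne_zero _)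
          (two_zpow_ne_top _), ENNReal.rpow_one]
        ring
    _ ≤ _ := by
        refine setLIntegral_mono' (measurableSet_layer _ _) fun x hx => ?_
        have hxz : x ≤ z := by rw [← hz]; have := hx.2; rwa [sub_add_cancel] at this
        gcongr
        · exact hE hxz
        · exact hx.1.le

theorem tsum_setLIntegral_layer_pred_le (η μ : Measure ℝ) (f : ℝ → ℝ≥0∞) :
    ∑' j : ℤ, ∫⁻ x in layer η (j - 1), f x ∂μ ≤ ∫⁻ x, f x ∂μ := by
  rw [show ∑' j : ℤ, ∫⁻ x in layer η (j - 1), f x ∂μ = _ from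
      (Equiv.subRight (1 : ℤ)).tsum_eq (fun j => ∫⁻ x in layer η j, f x ∂μ),
    ← lintegral_iUnion (measurableSet_layer η) (pairwise_disjoint_layer η)]
  exact setLIntegral_le_lintegral _ _

/-- The sufficiency part for general atomless measures. -/
theorem lintegral_rpow_tail_le (lam υ η : Measure ℝ) [NullSingletonClass lam]
    [NullSingletonClass η] {g : ℝ → ℝ≥0∞} (hg : Measurable g) {p q r : ℝ} (hp : 1 < p)
    (hq : 0 < q) (hqp : q < p) (hpr : p ≤ r) (hV : ∀ x, lam (Iic x) < ∞)
    (hW : ∀ x, η (Iic x) < ∞) (hN : ∫⁻ s, g s ^ p ∂lam ≠ ∞) :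
    ∫⁻ x, (∫⁻ y in Ioi x, lam.withDensity g (Iic y) ^ r ∂υ) ^ (q / r) ∂η ≤
      4 * 2 ^ q * (2 ^ q * 2 * (4 ^ q * 2 *
        lowerHardy lam (η.withDensity fun x => υ (Ioi x) ^ (q / r)) p q ^ ((p - q) / p)) +
        (2 ^ q + 4 ^ q) * (2 * envelopeEnergy lam υ η p q r ^ ((p - q) / p))) *
      (∫⁻ s, g s ^ p ∂lam) ^ (q / p) := by
  have hr : 0 < r := by linarith
  have hp0 : 0 < p := by linarith
  have hpq : 0 < p - q := by linarith
  have hθ : 0 < (p - q) / p := by positivity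
  set ν := lam.withDensity g with hν
  set N := ∫⁻ s, g s ^ p ∂lam with hNdef
  set κ := η.withDensity fun x => υ (Ioi x) ^ (q / r) with hκ
  obtain ⟨t, ht⟩ := exists_levels η hW
  classical
  set M : ℤ → ℝ≥0∞ := fun j =>
    if (layer η j).Nonempty then 2 ^ j * envelope lam υ p r (t j) ^ q else 0 with hM
  set Nl : ℤ → ℝ≥0∞ := fun j => ∫⁻ s in layer η j, g s ^ p ∂lam with hNl
  set I : ℤ → ℝ≥0∞ := fun j => ∫⁻ x in layer η j, ν (Iic x) ^ q * υ (Ioi x) ^ (q / r) ∂η with hI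
  have hterm : ∀ j, 4 * 2 ^ j * (∫⁻ y in layer η j, ν (Iic y) ^ r ∂υ) ^ (q / r) ≤
      4 * 2 ^ q * (2 ^ q * 2 * I (j - 1) + 2 ^ q * (M j * Nl (j - 1) ^ (q / p)) +
        4 ^ q * (M j * Nl j ^ (q / p))) := by
    intro j
    rcases (layer η j).eq_empty_or_nonempty with he | hne
    · have h0 : 0 < q / r := by positivity
      simp [he, h0]
    · obtain ⟨y, hy⟩ := hne
      obtain ⟨-, hz⟩ := ht j y hy.1
      have hmass := measure_layer_pred η hW hy.1
      have hB := rpow_setLIntegral_layer_le lam υ η hg hp hq hqp hpr hV hN hz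
      have hC := rpow_mul_measure_layer_le lam υ η hg hp hq hpr hz hmass
      have hMj : M j = 2 ^ j * envelope lam υ p r (t j) ^ q := if_pos ⟨y, hy⟩
      rw [hMj]
      calc _ ≤ _ := mul_le_mul' le_rfl hB
        _ = 4 * 2 ^ q * (2 ^ j * (ν (Iic (t j)) ^ q * υ (Ioi (t j)) ^ (q / r)) +
            4 ^ q * (2 ^ j * envelope lam υ p r (t j) ^ q * Nl j ^ (q / p))) := by ring
        _ ≤ _ := mul_le_mul' le_rfl (add_le_add hC le_rfl)
        _ = _ := by ring
  have hsumN : ∑' j, Nl j ≤ N := by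
    rw [← lintegral_iUnion (measurableSet_layer η) (pairwise_disjoint_layer η)]
    exact setLIntegral_le_lintegral _ _
  have hsumN' : ∑' j, Nl (j - 1) ≤ N := tsum_setLIntegral_layer_pred_le η lam _
  have hsumI : ∑' j, I (j - 1) ≤
      4 ^ q * 2 * lowerHardy lam κ p q ^ ((p - q) / p) * N ^ (q / p) := by
    refine (tsum_setLIntegral_layer_pred_le η η _).trans ?_
    have hm : Measurable fun x => υ (Ioi x) ^ (q / r) := (measurable_measure_Ioi υ).pow_const _
    refine (le_of_eq ?_).trans (lintegral_rpow_le_of_lt lam κ hg hp hq hqp hV hN)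
    rw [hκ, lintegral_withDensity_eq_lintegral_mul _ hm ((measurable_measure_Iic _).pow_const _)]
    exact lintegral_congr fun x => mul_comm _ _
  have hsumM : (∑' j, M j ^ (p / (p - q))) ^ ((p - q) / p) ≤
      2 * envelopeEnergy lam υ η p q r ^ ((p - q) / p) := by
    have h1 : ∑' j, M j ^ (p / (p - q)) ≤ 2 ^ (p / (p - q)) * envelopeEnergy lam υ η p q r := by
      calc ∑' j, M j ^ (p / (p - q)) ≤ ∑' j, 2 ^ (p / (p - q)) * ∫⁻ x in layer η (j - 1),
            envelope lam υ p r x ^ (p * q / (p - q)) * η (Iic x) ^ (q / (p - q)) ∂η := by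
            refine ENNReal.tsum_le_tsum fun j => ?_
            by_cases hne : (layer η j).Nonempty
            · obtain ⟨y, hy⟩ := id hne
              simp only [hM, if_pos hne]
              exact rpow_le_setLIntegral_layer η (antitone_envelope lam υ p r) hq hqp
                (ht j y hy.1).2 (measure_layer_pred η hW hy.1)
            · have h0 : 0 < p / (p - q) := by positivity
              simp [hM, if_neg hne, h0]
        _ ≤ _ := by
            rw [ENNReal.tsum_mul_left]
            gcongr
            exact tsum_setLIntegral_layer_pred_le η η _
    refine (ENNReal.rpow_le_rpow h1 hθ.le).trans (le_of_eq ?_)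
    rw [ENNReal.mul_rpow_of_nonneg _ _ hθ.le, ← ENNReal.rpow_mul,
      show p / (p - q) * ((p - q) / p) = 1 by field_simp, ENNReal.rpow_one]
  have hq0 : 0 ≤ q / p := by positivity
  have hMN : ∑' j, M j * Nl j ^ (q / p) ≤
      2 * envelopeEnergy lam υ η p q r ^ ((p - q) / p) * N ^ (q / p) :=
    (tsum_mul_rpow_le M Nl hq hqp).trans (mul_le_mul' hsumM (ENNReal.rpow_le_rpow hsumN hq0))
  have hMN' : ∑' j, M j * Nl (j - 1) ^ (q / p) ≤
      2 * envelopeEnergy lam υ η p q r ^ ((p - q) / p) * N ^ (q / p) :=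
    (tsum_mul_rpow_le M _ hq hqp).trans (mul_le_mul' hsumM (ENNReal.rpow_le_rpow hsumN' hq0))
  calc _ ≤ _ := lintegral_rpow_tail_le_tsum υ η hW _ (by positivity)
          (by rw [div_le_one hr]; linarith)
    _ ≤ _ := ENNReal.tsum_le_tsum hterm
    _ = 4 * 2 ^ q * (2 ^ q * 2 * ∑' j, I (j - 1) + 2 ^ q * ∑' j, (M j * Nl (j - 1) ^ (q / p)) +
        4 ^ q * ∑' j, (M j * Nl j ^ (q / p))) := by
        rw [ENNReal.tsum_mul_left, ENNReal.tsum_add, ENNReal.tsum_add, ENNReal.tsum_mul_left,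
          ENNReal.tsum_mul_left, ENNReal.tsum_mul_left]
    _ ≤ 4 * 2 ^ q * (2 ^ q * 2 * (4 ^ q * 2 * lowerHardy lam κ p q ^ ((p - q) / p) * N ^ (q / p)) +
        2 ^ q * (2 * envelopeEnergy lam υ η p q r ^ ((p - q) / p) * N ^ (q / p)) +
        4 ^ q * (2 * envelopeEnergy lam υ η p q r ^ ((p - q) / p) * N ^ (q / p))) := by
        gcongr
    _ = _ := by ring

/-! ### Necessity -/

theorem le_rpow_of_le_mul_rpow {A D : ℝ≥0∞} {p q : ℝ} (hq : 0 < q) (hqp : q < p) (hA : A ≠ ∞)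
    (h : A ≤ D * A ^ (q / p)) : A ≤ D ^ (p / (p - q)) := by
  have hpq : 0 < p - q := by linarith
  have hp0 : 0 < p := by linarith
  rcases eq_or_ne A 0 with rfl | h0
  · exact zero_le
  have hD : A ^ ((p - q) / p) ≤ D := by
    rw [show (p - q) / p = 1 - q / p by field_simp, ENNReal.rpow_sub _ _ h0 hA, ENNReal.rpow_one]
    exact ENNReal.div_le_of_le_mul h
  have := ENNReal.rpow_le_rpow hD (by positivity : 0 ≤ p / (p - q))
  rwa [← ENNReal.rpow_mul, show (p - q) / p * (p / (p - q)) = 1 by field_simp,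
    ENNReal.rpow_one] at this

theorem lintegral_withDensity_rpow_le (υ η : Measure ℝ) {H : ℝ → ℝ≥0∞} (hH : Monotone H)
    {q r : ℝ} (hq : 0 < q) (hr : 0 < r) :
    ∫⁻ x, H x ^ q ∂(η.withDensity fun x => υ (Ioi x) ^ (q / r)) ≤
      ∫⁻ x, (∫⁻ y in Ioi x, H y ^ r ∂υ) ^ (q / r) ∂η := by
  have hm : Measurable fun x => υ (Ioi x) ^ (q / r) := (measurable_measure_Ioi υ).pow_const _
  rw [lintegral_withDensity_eq_lintegral_mul _ hm (hH.measurable.pow_const _)]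
  refine lintegral_mono fun x => ?_
  calc υ (Ioi x) ^ (q / r) * H x ^ q = (∫⁻ _ in Ioi x, H x ^ r ∂υ) ^ (q / r) := by
        rw [setLIntegral_const, ENNReal.mul_rpow_of_nonneg _ _ (by positivity),
          ← ENNReal.rpow_mul, show r * (q / r) = q by field_simp, mul_comm]
    _ ≤ _ := by
        refine ENNReal.rpow_le_rpow ?_ (by positivity)
        exact setLIntegral_mono' measurableSet_Ioi fun y hy =>
          ENNReal.rpow_le_rpow (hH (le_of_lt hy)) hr.le

theorem lintegral_Ioi_swap (lam κ : Measure ℝ) [SFinite lam] [SFinite κ] {φ ψ : ℝ → ℝ≥0∞}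
    (hφ : Measurable φ) (hψ : Measurable ψ) :
    ∫⁻ t, φ t * ∫⁻ x in Ioi t, ψ x ∂κ ∂lam = ∫⁻ x, ψ x * ∫⁻ t in Iio x, φ t ∂lam ∂κ := by
  have hS : MeasurableSet {z : ℝ × ℝ | z.1 < z.2} := measurableSet_lt measurable_fst measurable_snd
  have hF : Measurable ({z : ℝ × ℝ | z.1 < z.2}.indicator fun z => φ z.1 * ψ z.2) :=
    Measurable.indicator (by fun_prop) hS
  have h1 : ∀ t, φ t * ∫⁻ x in Ioi t, ψ x ∂κ =
      ∫⁻ x, {z : ℝ × ℝ | z.1 < z.2}.indicator (fun z => φ z.1 * ψ z.2) (t, x) ∂κ := fun t => by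
    rw [← lintegral_const_mul _ hψ, ← lintegral_indicator measurableSet_Ioi]
    rfl
  have h2 : ∀ x, ψ x * ∫⁻ t in Iio x, φ t ∂lam =
      ∫⁻ t, {z : ℝ × ℝ | z.1 < z.2}.indicator (fun z => φ z.1 * ψ z.2) (t, x) ∂lam := fun x => by
    rw [mul_comm, ← lintegral_mul_const _ hφ, ← lintegral_indicator measurableSet_Iio]
    rfl
  simp_rw [h1, h2]
  exact lintegral_lintegral_swap hF.aemeasurable

theorem exists_lowerHardy_restrict_le {p q : ℝ} (hp : 1 < p) (hq : 0 < q) (hqp : q < p)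
    {K : ℝ≥0∞} (hK : K ≠ ∞) : ∃ D : ℝ≥0∞, D ≠ ∞ ∧
    ∀ (lam κ : Measure ℝ) [SFinite lam] [NullSingletonClass κ], (∀ x, lam (Iic x) < ∞) →
    (∀ g : ℝ → ℝ≥0∞, Measurable g → ∫⁻ x, lam.withDensity g (Iic x) ^ q ∂κ ≤
      K * (∫⁻ s, g s ^ p ∂lam) ^ (q / p)) →
    ∀ (B : Set ℝ) (b : ℝ), MeasurableSet B → B ⊆ Iic b → κ B < ∞ →
      lowerHardy lam (κ.restrict B) p q ≤ D := by
  have hpq : 0 < p - q := by linarith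
  have hp0 : 0 < p := by linarith
  have hp1 : 0 < p - 1 := by linarith
  set e : ℝ := (p - 1) * q / (p - q) with he
  set s : ℝ := q / (p - q) with hs
  set β : ℝ := (q - 1) / (p - q) with hβ
  have he0 : 0 < e := by positivity
  have hs0 : 0 < s := by positivity
  have hβ1 : β + 1 = (p - 1) / (p - q) := by rw [hβ]; field_simp; ring
  have hβ0 : -1 < β := by
    have : 0 < (p - 1) / (p - q) := by positivity
    linarith
  have hβp : β * p = e - 1 := by rw [hβ, he]; field_simp; ring
  have hs1 : s + 1 = p / (p - q) := by rw [hs]; field_simp; ring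
  obtain ⟨C, hC, hCV⟩ := exists_setLIntegral_rpow_le (a := e - 1) (by linarith)
  refine ⟨((2 ^ (β + 1)) ^ q * (K * (2 ^ (s + 1) * C) ^ (q / p))) ^ (p / (p - q)), ?_, ?_⟩
  · have h2 : ∀ a : ℝ, 0 ≤ a → (2 : ℝ≥0∞) ^ a ≠ ∞ := fun a ha =>
      ENNReal.rpow_ne_top_of_nonneg ha (by norm_num)
    refine ENNReal.rpow_ne_top_of_nonneg (by positivity) (ENNReal.mul_ne_top ?_
      (ENNReal.mul_ne_top hK ?_))
    · exact ENNReal.rpow_ne_top_of_nonneg hq.le (h2 _ (by linarith))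
    · exact ENNReal.rpow_ne_top_of_nonneg (by positivity)
        (ENNReal.mul_ne_top (h2 _ (by linarith)) hC)
  intro lam κ _ _ hV h B b hB hBb hκB
  set κB := κ.restrict B with hκBdef
  have : IsFiniteMeasure κB := ⟨by rw [hκBdef, Measure.restrict_apply_univ]; exact hκB⟩
  set Ω : ℝ → ℝ≥0∞ := fun x => κB (Ioi x) with hΩ
  set V : ℝ → ℝ≥0∞ := fun x => lam (Iic x) with hVdef
  have hΩm : Measurable Ω := measurable_measure_Ioi κB
  have hVm : Measurable V := measurable_measure_Iic lam
  set A := lowerHardy lam κB p q with hA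
  have hAeq : A = ∫⁻ x, Ω x ^ s * V x ^ e ∂κB := rfl
  have hAtop : A ≠ ∞ := by
    have : A ≤ κ B ^ s * V b ^ e * κ B := by
      rw [hAeq, hκBdef, ← setLIntegral_const]
      refine setLIntegral_mono' hB fun x hx => ?_
      gcongr
      · exact (measure_mono (subset_univ _)).trans (by rw [hκBdef, Measure.restrict_apply_univ])
      · exact monotone_measure_Iic lam (hBb hx)
    refine (this.trans_lt (ENNReal.mul_lt_top (ENNReal.mul_lt_top ?_ ?_) hκB)).ne
    · exact ENNReal.rpow_lt_top_of_nonneg hs0.le hκB.ne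
    · exact ENNReal.rpow_lt_top_of_nonneg he0.le (hV b).ne
  set g : ℝ → ℝ≥0∞ := fun t => Ω t ^ (1 / (p - q)) * V t ^ β with hg
  have hgm : Measurable g := (hΩm.pow_const _).mul (hVm.pow_const _)
  have hNg : ∫⁻ t, g t ^ p ∂lam ≤ 2 ^ (s + 1) * C * A := by
    calc ∫⁻ t, g t ^ p ∂lam
        ≤ ∫⁻ t, 2 ^ (s + 1) * (V t ^ (e - 1) * ∫⁻ x in Ioi t, Ω x ^ s ∂κB) ∂lam := by
          refine lintegral_mono fun t => ?_
          simp only [hg]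
          rw [ENNReal.mul_rpow_of_nonneg _ _ hp0.le, ← ENNReal.rpow_mul, ← ENNReal.rpow_mul, hβp,
            one_div_mul_eq_div, ← hs1, mul_left_comm, mul_comm]
          gcongr
          exact rpow_succ_le_setLIntegral_Ioi κB (Ioi t) hs0.le
      _ = 2 ^ (s + 1) * ∫⁻ x, Ω x ^ s * ∫⁻ t in Iio x, V t ^ (e - 1) ∂lam ∂κB := by
          rw [lintegral_const_mul' _ _ (ENNReal.rpow_ne_top_of_nonneg (by linarith) (by norm_num)),
            lintegral_Ioi_swap lam κB (hVm.pow_const _) (hΩm.pow_const _)]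
      _ ≤ 2 ^ (s + 1) * ∫⁻ x, C * (Ω x ^ s * V x ^ e) ∂κB := by
          gcongr 2 ^ (s + 1) * ?_
          refine lintegral_mono fun x => ?_
          rw [mul_left_comm]
          gcongr
          refine (lintegral_mono_set Iio_subset_Iic_self).trans ((hCV lam x (hV x).ne).trans ?_)
          rw [sub_add_cancel]
      _ = _ := by rw [lintegral_const_mul' _ _ hC, ← hAeq, mul_assoc]
  have hlow : ∀ x, Ω x ^ s * V x ^ e ≤ (2 ^ (β + 1)) ^ q * lam.withDensity g (Iic x) ^ q := by
    intro x
    have h1 : Ω x ^ (1 / (p - q)) * V x ^ (β + 1) ≤ 2 ^ (β + 1) * lam.withDensity g (Iic x) := by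
      calc Ω x ^ (1 / (p - q)) * V x ^ (β + 1)
          ≤ Ω x ^ (1 / (p - q)) * (2 ^ (β + 1) * ∫⁻ y in Iic x, V y ^ β ∂lam) := by
            gcongr
            exact rpow_succ_le_setLIntegral_Iic lam (hV x).ne hβ0
        _ = 2 ^ (β + 1) * ∫⁻ y in Iic x, Ω x ^ (1 / (p - q)) * V y ^ β ∂lam := by
            rw [lintegral_const_mul _ (hVm.pow_const _)]; ring
        _ ≤ _ := by
            rw [withDensity_Iic]
            gcongr 2 ^ (β + 1) * ?_
            refine setLIntegral_mono' measurableSet_Iic fun y hy => ?_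
            simp only [hg]
            gcongr
            exact antitone_measure_Ioi κB hy
    have h2 := ENNReal.rpow_le_rpow h1 hq.le
    rw [ENNReal.mul_rpow_of_nonneg _ _ hq.le, ENNReal.mul_rpow_of_nonneg _ _ hq.le,
      ← ENNReal.rpow_mul, ← ENNReal.rpow_mul, hβ1, one_div_mul_eq_div, div_mul_eq_mul_div] at h2
    rwa [hβ1]
  refine le_rpow_of_le_mul_rpow hq hqp hAtop ?_
  calc A ≤ ∫⁻ x, (2 ^ (β + 1)) ^ q * lam.withDensity g (Iic x) ^ q ∂κB :=
        lintegral_mono hlow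
    _ = (2 ^ (β + 1)) ^ q * ∫⁻ x, lam.withDensity g (Iic x) ^ q ∂κB :=
        lintegral_const_mul _ ((measurable_measure_Iic _).pow_const _)
    _ ≤ (2 ^ (β + 1)) ^ q * (K * (2 ^ (s + 1) * C * A) ^ (q / p)) := by
        gcongr
        refine (setLIntegral_le_lintegral _ _).trans ((h g hgm).trans ?_)
        gcongr
    _ = _ := by
        rw [ENNReal.mul_rpow_of_nonneg _ _ (by positivity : 0 ≤ q / p)]
        ring

theorem lowerHardy_lt_top (lam κ : Measure ℝ) [SFinite lam] [NullSingletonClass κ]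
    [SigmaFinite κ] {p q : ℝ} (hp : 1 < p) (hq : 0 < q) (hqp : q < p)
    {K : ℝ≥0∞} (hK : K ≠ ∞) (hV : ∀ x, lam (Iic x) < ∞)
    (h : ∀ g : ℝ → ℝ≥0∞, Measurable g → ∫⁻ x, lam.withDensity g (Iic x) ^ q ∂κ ≤
      K * (∫⁻ s, g s ^ p ∂lam) ^ (q / p)) :
    lowerHardy lam κ p q < ∞ := by
  have hpq : 0 < p - q := by linarith
  have hp1 : 0 < p - 1 := by linarith
  obtain ⟨D, hD, hDle⟩ := exists_lowerHardy_restrict_le hp hq hqp hK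
  refine lt_of_le_of_lt ?_ hD.lt_top
  set B : ℕ → Set ℝ := fun n => spanningSets κ n ∩ Iic (n : ℝ) with hB
  have hBm : ∀ n, MeasurableSet (B n) := fun n =>
    (measurableSet_spanningSets κ n).inter measurableSet_Iic
  have hBmono : Monotone B := fun m n hmn => inter_subset_inter (monotone_spanningSets κ hmn)
    (Iic_subset_Iic.2 (by exact_mod_cast hmn))
  have hBx : ∀ x, ∃ n, x ∈ B n := fun x => by
    obtain ⟨m, hm⟩ := exists_nat_ge x
    exact ⟨max (spanningSetsIndex κ x) m, monotone_spanningSets κ (le_max_left _ _)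
      (mem_spanningSetsIndex κ x), hm.trans (by exact_mod_cast le_max_right _ _)⟩
  set F : ℕ → ℝ → ℝ≥0∞ := fun n => (B n).indicator fun x =>
    κ.restrict (B n) (Ioi x) ^ (q / (p - q)) * lam (Iic x) ^ ((p - 1) * q / (p - q)) with hF
  have hFm : ∀ n, Measurable (F n) := fun n =>
    (((measurable_measure_Ioi _).pow_const _).mul
      ((measurable_measure_Iic _).pow_const _)).indicator (hBm n)
  have hlim := lintegral_tendsto_of_tendsto_of_monotone (μ := κ) (f := F)
    (F := fun x => κ (Ioi x) ^ (q / (p - q)) * lam (Iic x) ^ ((p - 1) * q / (p - q)))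
    (fun n => (hFm n).aemeasurable)
    (Filter.Eventually.of_forall fun x m n hmn => by
      refine (indicator_le_indicator ?_).trans
        (indicator_le_indicator_of_subset (hBmono hmn) (fun _ => zero_le) x)
      gcongr
      exact hBmono hmn)
    (Filter.Eventually.of_forall fun x => by
      obtain ⟨N, hN⟩ := hBx x
      have h1 : Filter.Tendsto (fun n => κ.restrict (B n) (Ioi x)) Filter.atTop
          (nhds (κ (Ioi x))) := by
        have h2 := tendsto_measure_iUnion_atTop (μ := κ) (s := fun n => Ioi x ∩ B n)
          (fun m n hmn => inter_subset_inter_right _ (hBmono hmn))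
        rw [← inter_iUnion, iUnion_eq_univ_iff.2 hBx, inter_univ] at h2
        exact h2.congr fun n => (Measure.restrict_apply measurableSet_Ioi).symm
      refine Filter.Tendsto.congr' ?_ (ENNReal.Tendsto.mul_const
        ((ENNReal.continuous_rpow_const.tendsto _).comp h1)
        (Or.inr (ENNReal.rpow_ne_top_of_nonneg (by positivity) (hV x).ne)))
      filter_upwards [Filter.eventually_ge_atTop N] with n hn
      simp only [hF]
      rw [indicator_of_mem (hBmono hn hN)]
      rfl)
  refine le_of_tendsto' hlim fun n => ?_
  rw [lintegral_indicator (hBm n)]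
  exact hDle lam κ hV h (B n) n (hBm n) inter_subset_right
    ((measure_mono inter_subset_left).trans_lt (measure_spanningSets_lt_top κ n))

theorem rpow_mul_measure_Iic_le (lam υ η : Measure ℝ) {p q r : ℝ} (hp : 1 < p) (hq : 0 < q)
    (hr : 0 < r) {K : ℝ≥0∞}
    (h : ∀ g : ℝ → ℝ≥0∞, Measurable g →
      ∫⁻ x, (∫⁻ y in Ioi x, lam.withDensity g (Iic y) ^ r ∂υ) ^ (q / r) ∂η ≤
        K * (∫⁻ s, g s ^ p ∂lam) ^ (q / p)) {t : ℝ} (hV : lam (Iic t) < ∞) :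
    (υ (Ioi t) ^ (1 / r) * lam (Iic t) ^ ((p - 1) / p)) ^ q * η (Iic t) ≤ K := by
  have hp0 : 0 < p := by linarith
  have hp1 : 0 < p - 1 := by linarith
  rcases eq_or_ne (lam (Iic t)) 0 with h0 | h0
  · rw [h0, ENNReal.zero_rpow_of_pos (by positivity), mul_zero, ENNReal.zero_rpow_of_pos hq,
      zero_mul]
    exact zero_le
  have h1 := h ((Iic t).indicator 1) (measurable_one.indicator measurableSet_Iic)
  have e1 : ∫⁻ s, (Iic t).indicator (1 : ℝ → ℝ≥0∞) s ^ p ∂lam = lam (Iic t) := by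
    rw [← lintegral_indicator_one measurableSet_Iic]
    congr 1 with s
    by_cases hs : s ∈ Iic t <;> simp [hs, hp0]
  rw [e1] at h1
  have h2 : (υ (Ioi t) * lam (Iic t) ^ r) ^ (q / r) * η (Iic t) ≤
      K * lam (Iic t) ^ (q / p) := by
    refine le_trans ?_ h1
    rw [← setLIntegral_const]
    refine le_trans ?_ (setLIntegral_le_lintegral (Iic t) _)
    refine setLIntegral_mono' measurableSet_Iic fun x hx => ENNReal.rpow_le_rpow ?_ (by positivity)
    rw [mul_comm, ← setLIntegral_const]
    refine (setLIntegral_mono' measurableSet_Ioi fun y hy => ?_).trans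
      (lintegral_mono_set (Ioi_subset_Ioi hx))
    refine ENNReal.rpow_le_rpow ?_ hr.le
    rw [withDensity_indicator_one measurableSet_Iic, Measure.restrict_apply measurableSet_Iic]
    exact measure_mono fun s (hs : s ≤ t) => ⟨hs.trans (le_of_lt hy), hs⟩
  have hc0 : lam (Iic t) ^ (q / p) ≠ 0 := by simp [h0, hV.ne]
  have hct : lam (Iic t) ^ (q / p) ≠ ∞ := ENNReal.rpow_ne_top_of_nonneg (by positivity) hV.ne
  refine (ENNReal.mul_le_mul_iff_left hc0 hct).1 (le_trans (le_of_eq ?_) h2)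
  rw [ENNReal.mul_rpow_of_nonneg _ _ hq.le, ENNReal.mul_rpow_of_nonneg _ _ (by positivity),
    ← ENNReal.rpow_mul, ← ENNReal.rpow_mul, ← ENNReal.rpow_mul, one_div_mul_eq_div,
    show r * (q / r) = (p - 1) / p * q + q / p by field_simp; ring,
    ENNReal.rpow_add _ _ h0 hV.ne]
  ring

theorem envelope_lt_top (lam υ η : Measure ℝ) {p q r : ℝ} (hq : 0 < q)
    {K : ℝ≥0∞} (hK : K ≠ ∞)
    (h : ∀ t, (υ (Ioi t) ^ (1 / r) * lam (Iic t) ^ ((p - 1) / p)) ^ q * η (Iic t) ≤ K) {x : ℝ}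
    (hx : η (Iic x) ≠ 0) : envelope lam υ p r x < ∞ := by
  have hb : envelope lam υ p r x ≤ (K / η (Iic x)) ^ (1 / q) := by
    refine iSup₂_le fun t ht => ?_
    rw [one_div q, ENNReal.le_rpow_inv_iff hq]
    refine ENNReal.le_div_iff_mul_le (Or.inl hx) (Or.inr hK) |>.2 (le_trans ?_ (h t))
    gcongr
    exact ht
  exact hb.trans_lt (ENNReal.rpow_lt_top_of_nonneg (by positivity) (ENNReal.div_ne_top hK hx))

theorem exists_envelope_le (lam υ : Measure ℝ) {p r x : ℝ} (h : envelope lam υ p r x < ∞) :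
    ∃ t, x ≤ t ∧
      envelope lam υ p r x ≤ 2 * (υ (Ioi t) ^ (1 / r) * lam (Iic t) ^ ((p - 1) / p)) := by
  rcases eq_or_ne (envelope lam υ p r x) 0 with h0 | h0
  · exact ⟨x, le_rfl, by rw [h0]; exact zero_le⟩
  · have hlt := ENNReal.half_lt_self h0 h.ne
    conv_rhs at hlt => rw [envelope]
    obtain ⟨t, ht⟩ := lt_iSup_iff.1 hlt
    obtain ⟨hxt, ht⟩ := lt_iSup_iff.1 ht
    refine ⟨t, hxt, ?_⟩
    rw [mul_comm]
    exact (ENNReal.div_le_iff_le_mul (by simp) (by simp)).1 ht.le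

/-- Testing the inequality on a superposition of truncated constants. -/
theorem sum_rpow_le_of_inequality (lam υ η : Measure ℝ) {p q r : ℝ} (hp : 1 < p) (hq : 0 < q)
    (hqp : q < p) (hr : 0 < r) {K : ℝ≥0∞}
    (h : ∀ g : ℝ → ℝ≥0∞, Measurable g →
      ∫⁻ x, (∫⁻ y in Ioi x, lam.withDensity g (Iic y) ^ r ∂υ) ^ (q / r) ∂η ≤
        K * (∫⁻ s, g s ^ p ∂lam) ^ (q / p)) (hV : ∀ x, lam (Iic x) < ∞) (τ : ℤ → ℝ)
    (F : Finset ℤ) (hF : ∀ k ∈ F, η (layer η (k - 1)) = 2 ^ (k - 1) ∧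
      (∀ x ∈ layer η (k - 1), x ≤ τ k) ∧
      υ (Ioi (τ k)) ^ (1 / r) * lam (Iic (τ k)) ^ ((p - 1) / p) ≠ ∞) :
    ∑ k ∈ F, (2 ^ k * (υ (Ioi (τ k)) ^ (1 / r) * lam (Iic (τ k)) ^ ((p - 1) / p)) ^ q) ^
      (p / (p - q)) ≤ (2 * K) ^ (p / (p - q)) := by
  have hp0 : 0 < p := by linarith
  have hp1 : 0 < p - 1 := by linarith
  have hpq : 0 < p - q := by linarith
  set S : ℤ → ℝ≥0∞ := fun k => υ (Ioi (τ k)) ^ (1 / r) * lam (Iic (τ k)) ^ ((p - 1) / p) with hS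
  set c : ℤ → ℝ≥0∞ := fun k => (2 ^ k * S k ^ q) ^ (p / (p - q)) with hc
  have hct : ∀ k ∈ F, c k ≠ ∞ := fun k hk => ENNReal.rpow_ne_top_of_nonneg (by positivity)
    (ENNReal.mul_ne_top (two_zpow_ne_top k) (ENNReal.rpow_ne_top_of_nonneg hq.le (hF k hk).2.2))
  set G : ℝ → ℝ≥0∞ := fun x => ∑ k ∈ F, (Iic (τ k)).indicator
    (fun _ => c k * (lam (Iic (τ k)))⁻¹) x with hG
  have hGm : Measurable G :=
    Finset.measurable_fun_sum _ fun k _ => measurable_const.indicator measurableSet_Iic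
  have hGint : ∫⁻ s, (G s ^ (1 / p)) ^ p ∂lam ≤ ∑ k ∈ F, c k := by
    have e : ∀ s, (G s ^ (1 / p)) ^ p = G s := fun s => by
      rw [← ENNReal.rpow_mul, one_div_mul_cancel hp0.ne', ENNReal.rpow_one]
    simp_rw [e, hG]
    rw [lintegral_finsetSum _ fun k _ => measurable_const.indicator measurableSet_Iic]
    refine Finset.sum_le_sum fun k _ => ?_
    rw [lintegral_indicator measurableSet_Iic, setLIntegral_const, mul_assoc]
    exact mul_le_of_le_one_right' (ENNReal.inv_mul_le_one _)
  set H : ℝ → ℝ≥0∞ := fun y => lam.withDensity (fun s => G s ^ (1 / p)) (Iic y) with hH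
  have hHlow : ∀ k ∈ F, c k ^ (q / p) * S k ^ q ≤ υ (Ioi (τ k)) ^ (q / r) * H (τ k) ^ q := by
    intro k hk
    rcases eq_or_ne (lam (Iic (τ k))) 0 with h0 | h0
    · have : S k = 0 := by
        simp only [hS]
        rw [h0, ENNReal.zero_rpow_of_pos (by positivity), mul_zero]
      rw [this, ENNReal.zero_rpow_of_pos hq, mul_zero]
      exact zero_le
    have h1 : c k ^ (1 / p) * lam (Iic (τ k)) ^ ((p - 1) / p) ≤ H (τ k) := by
      calc c k ^ (1 / p) * lam (Iic (τ k)) ^ ((p - 1) / p)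
          = (c k * (lam (Iic (τ k)))⁻¹) ^ (1 / p) * lam (Iic (τ k)) := by
            rw [ENNReal.mul_rpow_of_nonneg _ _ (by positivity), mul_assoc,
              ENNReal.inv_rpow, ← ENNReal.rpow_neg]
            nth_rw 3 [← ENNReal.rpow_one (lam (Iic (τ k)))]
            rw [← ENNReal.rpow_add _ _ h0 (hV _).ne]
            congr 2
            field_simp
            ring
        _ ≤ _ := by
            simp only [hH]
            rw [withDensity_Iic, ← setLIntegral_const]
            refine setLIntegral_mono' measurableSet_Iic fun s hs => ?_
            refine ENNReal.rpow_le_rpow ?_ (by positivity)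
            refine le_trans ?_ (Finset.single_le_sum (fun _ _ => zero_le) hk)
            rw [indicator_of_mem hs]
    calc c k ^ (q / p) * S k ^ q
        = υ (Ioi (τ k)) ^ (q / r) * (c k ^ (1 / p) * lam (Iic (τ k)) ^ ((p - 1) / p)) ^ q := by
          simp only [hS]
          rw [ENNReal.mul_rpow_of_nonneg _ _ hq.le, ENNReal.mul_rpow_of_nonneg _ _ hq.le,
            ← ENNReal.rpow_mul _ (1 / r), ← ENNReal.rpow_mul (c k) (1 / p), one_div_mul_eq_div,
            one_div_mul_eq_div]
          ring
      _ ≤ _ := by gcongr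
  have hterm : ∀ k ∈ F, c k ≤
      2 * ∫⁻ x in layer η (k - 1), (∫⁻ y in Ioi x, H y ^ r ∂υ) ^ (q / r) ∂η := by
    intro k hk
    obtain ⟨hmass, hle, -⟩ := hF k hk
    have h2k : (2 : ℝ≥0∞) ^ k = 2 * 2 ^ (k - 1) := by rw [← two_zpow_succ, sub_add_cancel]
    calc c k = 2 ^ k * S k ^ q * c k ^ (q / p) := by
          simp only [hc]
          rw [← ENNReal.rpow_mul, show p / (p - q) * (q / p) = q / (p - q) by field_simp,
            show p / (p - q) = 1 + q / (p - q) by field_simp; ring,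
            ENNReal.rpow_add_of_nonneg _ _ zero_le_one (by positivity), ENNReal.rpow_one]
      _ = 2 * ((c k ^ (q / p) * S k ^ q) * 2 ^ (k - 1)) := by rw [h2k]; ring
      _ ≤ 2 * ((υ (Ioi (τ k)) ^ (q / r) * H (τ k) ^ q) * 2 ^ (k - 1)) := by
          gcongr 2 * (?_ * _)
          exact hHlow k hk
      _ = 2 * ∫⁻ _ in layer η (k - 1), (υ (Ioi (τ k)) ^ (q / r) * H (τ k) ^ q) ∂η := by
          rw [setLIntegral_const, hmass]
      _ ≤ _ := by
          gcongr 2 * ?_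
          refine setLIntegral_mono' (measurableSet_layer _ _) fun x hx => ?_
          calc υ (Ioi (τ k)) ^ (q / r) * H (τ k) ^ q
              = (∫⁻ _ in Ioi (τ k), H (τ k) ^ r ∂υ) ^ (q / r) := by
                rw [setLIntegral_const, ENNReal.mul_rpow_of_nonneg _ _ (by positivity),
                  ← ENNReal.rpow_mul, show r * (q / r) = q by field_simp, mul_comm]
            _ ≤ _ := by
                refine ENNReal.rpow_le_rpow ?_ (by positivity)
                refine (setLIntegral_mono' measurableSet_Ioi fun y hy => ?_).trans
                  (lintegral_mono_set (Ioi_subset_Ioi (hle x hx)))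
                exact ENNReal.rpow_le_rpow (monotone_measure_Iic _ (le_of_lt hy)) hr.le
  refine le_rpow_of_le_mul_rpow hq hqp (ENNReal.sum_ne_top.2 hct) ?_
  calc ∑ k ∈ F, c k ≤ ∑ k ∈ F, 2 * ∫⁻ x in layer η (k - 1),
        (∫⁻ y in Ioi x, H y ^ r ∂υ) ^ (q / r) ∂η := Finset.sum_le_sum hterm
    _ ≤ 2 * ∫⁻ x, (∫⁻ y in Ioi x, H y ^ r ∂υ) ^ (q / r) ∂η := by
        rw [← Finset.mul_sum]
        gcongr 2 * ?_
        exact (ENNReal.sum_le_tsum F).trans (tsum_setLIntegral_layer_pred_le η η _)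
    _ ≤ 2 * (K * (∑ k ∈ F, c k) ^ (q / p)) := by
        gcongr 2 * ?_
        exact (h _ (hGm.pow_const _)).trans (by gcongr)
    _ = _ := by ring

theorem envelopeEnergy_lt_top (lam υ η : Measure ℝ) [NullSingletonClass η] {p q r : ℝ}
    (hp : 1 < p) (hq : 0 < q) (hqp : q < p) (hr : 0 < r) {K : ℝ≥0∞} (hK : K ≠ ∞)
    (h : ∀ g : ℝ → ℝ≥0∞, Measurable g →
      ∫⁻ x, (∫⁻ y in Ioi x, lam.withDensity g (Iic y) ^ r ∂υ) ^ (q / r) ∂η ≤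
        K * (∫⁻ s, g s ^ p ∂lam) ^ (q / p))
    (hV : ∀ x, lam (Iic x) < ∞) (hW : ∀ x, η (Iic x) < ∞) :
    envelopeEnergy lam υ η p q r < ∞ := by
  have hp0 : 0 < p := by linarith
  have hpq : 0 < p - q := by linarith
  obtain ⟨t, ht⟩ := exists_levels η hW
  set S : ℝ → ℝ≥0∞ := fun x => υ (Ioi x) ^ (1 / r) * lam (Iic x) ^ ((p - 1) / p) with hS
  have hEt : ∀ k, (layer η k).Nonempty → envelope lam υ p r (t k) < ∞ := fun k ⟨y, hy⟩ =>
    envelope_lt_top lam υ η hq hK (fun t => rpow_mul_measure_Iic_le lam υ η hp hq hr h (hV t))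
      (by rw [(ht k y hy.1).1]; exact two_zpow_ne_zero k)
  have hτ : ∀ k, ∃ τ, (layer η k).Nonempty →
      t k ≤ τ ∧ envelope lam υ p r (t k) ≤ 2 * S τ := fun k => by
    by_cases hk : (layer η k).Nonempty
    · obtain ⟨τ, h1, h2⟩ := exists_envelope_le lam υ (hEt k hk)
      exact ⟨τ, fun _ => ⟨h1, h2⟩⟩
    · exact ⟨0, fun h => absurd h hk⟩
  choose τ hτ using hτ
  classical
  set c : ℤ → ℝ≥0∞ := fun k =>
    if (layer η k).Nonempty then (2 ^ k * S (τ k) ^ q) ^ (p / (p - q)) else 0 with hc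
  have hsum : ∑' k, c k ≤ (2 * K) ^ (p / (p - q)) := by
    rw [ENNReal.tsum_eq_iSup_sum]
    refine iSup_le fun F => ?_
    simp only [hc]
    rw [← Finset.sum_filter]
    refine sum_rpow_le_of_inequality lam υ η hp hq hqp hr h hV τ _ fun k hk => ?_
    have hne := (Finset.mem_filter.1 hk).2
    obtain ⟨y, hy⟩ := id hne
    obtain ⟨-, hz⟩ := ht k y hy.1
    refine ⟨measure_layer_pred η hW hy.1, fun x hx => ?_, ?_⟩
    · refine le_trans ?_ (hτ k hne).1
      rw [← hz]
      have := hx.2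
      rwa [sub_add_cancel] at this
    · exact ((le_envelope lam υ p r (hτ k hne).1).trans_lt (hEt k hne)).ne
  have hlayer : ∀ k, ∫⁻ x in layer η k,
      envelope lam υ p r x ^ (p * q / (p - q)) * η (Iic x) ^ (q / (p - q)) ∂η ≤
      2 ^ (p * q / (p - q)) * 2 ^ (p / (p - q)) * c k := by
    intro k
    rcases (layer η k).eq_empty_or_nonempty with he | hne
    · simp [he]
    obtain ⟨y, hy⟩ := id hne
    obtain ⟨-, hz⟩ := ht k y hy.1
    have hqs : 0 ≤ q / (p - q) := by positivity
    have e1 : p / (p - q) = q / (p - q) + 1 := by field_simp; ring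
    calc _ ≤ ∫⁻ _ in layer η k, (2 * S (τ k)) ^ (p * q / (p - q)) *
          (2 * 2 ^ k) ^ (q / (p - q)) ∂η := by
          refine setLIntegral_mono' (measurableSet_layer _ _) fun x hx => ?_
          gcongr
          · refine (antitone_envelope lam υ p r ?_).trans (hτ k hne).2
            refine le_of_lt ?_
            rw [← not_le, ← hz, not_le]
            exact hx.1
          · rw [← two_zpow_succ]
            exact hx.2
      _ ≤ (2 * S (τ k)) ^ (p * q / (p - q)) * (2 * 2 ^ k) ^ (q / (p - q)) * (2 * 2 ^ k) := by
          rw [setLIntegral_const]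
          gcongr
          rw [← two_zpow_succ]
          exact measure_layer_le η k
      _ = (2 * S (τ k)) ^ (p * q / (p - q)) * (2 * 2 ^ k) ^ (p / (p - q)) := by
          rw [e1, ENNReal.rpow_add_of_nonneg _ _ hqs zero_le_one, ENNReal.rpow_one, mul_assoc]
      _ = _ := by
          simp only [hc, if_pos hne]
          have e2 : q * (p / (p - q)) = p * q / (p - q) := by field_simp
          rw [ENNReal.mul_rpow_of_nonneg _ (S (τ k)) (by positivity),
            ENNReal.mul_rpow_of_nonneg _ (2 ^ k) (by positivity),
            ENNReal.mul_rpow_of_nonneg _ (S (τ k) ^ q) (by positivity),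
            ← ENNReal.rpow_mul (S (τ k)), e2]
          ring
  have h2 : ∀ a : ℝ, 0 ≤ a → (2 : ℝ≥0∞) ^ a ≠ ∞ := fun a ha =>
    ENNReal.rpow_ne_top_of_nonneg ha (by norm_num)
  calc envelopeEnergy lam υ η p q r ≤ ∑' k, 2 ^ (p * q / (p - q)) * 2 ^ (p / (p - q)) * c k := by
        rw [envelopeEnergy, lintegral_eq_tsum_layer η η hW _
          ((ae_measure_Iic_ne_zero η).mono fun x hx h => absurd h hx)]
        exact ENNReal.tsum_le_tsum hlayer
    _ ≤ 2 ^ (p * q / (p - q)) * 2 ^ (p / (p - q)) * (2 * K) ^ (p / (p - q)) := by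
        rw [ENNReal.tsum_mul_left]
        gcongr
    _ < ∞ := ENNReal.mul_lt_top (ENNReal.mul_lt_top (h2 _ (by positivity)).lt_top
        (h2 _ (by positivity)).lt_top) (ENNReal.rpow_lt_top_of_nonneg (by positivity)
          (ENNReal.mul_ne_top (by norm_num) hK))

/-! ### Weights on `(0, ∞)` -/

instance : NullSingletonClass mu0 := by
  unfold mu0
  infer_instance

instance : SigmaFinite mu0 := by
  unfold mu0
  infer_instance

theorem mu0_restrict_Iic (x : ℝ) : mu0.restrict (Iic x) = volume.restrict (Ioc 0 x) := by
  rw [mu0, Measure.restrict_restrict measurableSet_Iic, Iic_inter_Ioi]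

theorem mu0_restrict_Ioi {x : ℝ} (hx : 0 ≤ x) : mu0.restrict (Ioi x) = volume.restrict (Ioi x) := by
  rw [mu0, Measure.restrict_restrict measurableSet_Ioi, Ioi_inter_Ioi, max_eq_left hx]

theorem withDensity_mu0_Iic (f : ℝ → ℝ≥0∞) (x : ℝ) :
    mu0.withDensity f (Iic x) = ∫⁻ t in Ioc 0 x, f t := by
  rw [withDensity_apply _ measurableSet_Iic, mu0_restrict_Iic]

theorem withDensity_mu0_Ioi (f : ℝ → ℝ≥0∞) {x : ℝ} (hx : 0 ≤ x) :
    mu0.withDensity f (Ioi x) = ∫⁻ t in Ioi x, f t := by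
  rw [withDensity_apply _ measurableSet_Ioi, mu0_restrict_Ioi hx]

theorem lintegral_withDensity_mu0 {f G : ℝ → ℝ≥0∞} (hf : Measurable f) (hG : Measurable G) :
    ∫⁻ x, G x ∂(mu0.withDensity f) = ∫⁻ x in Ioi 0, G x * f x := by
  rw [lintegral_withDensity_eq_lintegral_mul _ hf hG]
  exact lintegral_congr fun x => mul_comm _ _

theorem setLIntegral_Ioi_withDensity_mu0 {f G : ℝ → ℝ≥0∞} (hf : Measurable f) (hG : Measurable G)
    {x : ℝ} (hx : 0 ≤ x) :
    ∫⁻ y in Ioi x, G y ∂(mu0.withDensity f) = ∫⁻ y in Ioi x, G y * f y := by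
  rw [setLIntegral_withDensity_eq_setLIntegral_mul _ hf hG measurableSet_Ioi, mu0_restrict_Ioi hx]
  exact lintegral_congr fun x => mul_comm _ _

theorem IsWeight.withDensity_ne_zero {f : ℝ → ℝ≥0∞} (hf : IsWeight f) {s : Set ℝ}
    (hs : mu0 s ≠ 0) : mu0.withDensity f s ≠ 0 := fun h =>
  hs (withDensity_absolutelyContinuous' hf.1.aemeasurable (hf.2.mono fun _ hx => hx.1.ne') h)

theorem IsWeight.rpow {f : ℝ → ℝ≥0∞} (hf : IsWeight f) (a : ℝ) : IsWeight fun x => f x ^ a :=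
  ⟨hf.1.pow_const a, hf.2.mono fun _ hx =>
    ⟨ENNReal.rpow_pos hx.1 hx.2.ne, (ENNReal.rpow_ne_top_of_ne_zero hx.1.ne' hx.2.ne).lt_top⟩⟩

theorem mu0_Iic_ne_zero {x : ℝ} (hx : 0 < x) : mu0 (Iic x) ≠ 0 := by
  rw [mu0, Measure.restrict_apply measurableSet_Iic, Iic_inter_Ioi, Real.volume_Ioc]
  simpa using hx

theorem mu0_Ioi_ne_zero (x : ℝ) : mu0 (Ioi x) ≠ 0 := by
  rw [mu0, Measure.restrict_apply measurableSet_Ioi, Ioi_inter_Ioi, Real.volume_Ioi]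
  simp

theorem withDensity_mu0_Iic_of_nonpos (f : ℝ → ℝ≥0∞) {x : ℝ} (hx : x ≤ 0) :
    mu0.withDensity f (Iic x) = 0 := by
  rw [withDensity_mu0_Iic, Ioc_eq_empty (not_lt.2 hx), Measure.restrict_empty,
    lintegral_zero_measure]

theorem lintegral_hardy_eq {σ g h u w : ℝ → ℝ≥0∞} (hσ : Measurable σ) (hg : Measurable g)
    (hu : Measurable u) (hw : Measurable w) (hgh : ∀ᵐ x ∂mu0, g x * σ x = h x) (q r : ℝ) :
    ∫⁻ x, (∫⁻ y in Ioi x, (mu0.withDensity σ).withDensity g (Iic y) ^ r ∂(mu0.withDensity u)) ^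
        (q / r) ∂(mu0.withDensity w) =
      ∫⁻ x in Ioi (0 : ℝ), (∫⁻ t in Ioi x, (∫⁻ s in Ioc (0 : ℝ) t, h s) ^ r * u t) ^ (q / r) *
        w x := by
  have hH : ∀ y, (mu0.withDensity σ).withDensity g (Iic y) = ∫⁻ s in Ioc (0 : ℝ) y, h s := by
    intro y
    rw [withDensity_Iic, setLIntegral_withDensity_eq_setLIntegral_mul _ hσ hg measurableSet_Iic,
      ← mu0_restrict_Iic]
    refine lintegral_congr_ae (ae_restrict_of_ae ?_)
    filter_upwards [hgh] with x hx
    rw [← hx]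
    exact mul_comm _ _
  have hHm : Measurable fun y => (mu0.withDensity σ).withDensity g (Iic y) ^ r :=
    (measurable_measure_Iic _).pow_const _
  have hA : Antitone fun x => ∫⁻ y in Ioi x, (mu0.withDensity σ).withDensity g (Iic y) ^ r
      ∂(mu0.withDensity u) := fun a b hab => lintegral_mono_set (Ioi_subset_Ioi hab)
  rw [lintegral_withDensity_mu0 hw (hA.measurable.pow_const _)]
  refine setLIntegral_congr_fun measurableSet_Ioi fun x hx => ?_
  rw [setLIntegral_Ioi_withDensity_mu0 hu hHm (le_of_lt hx)]
  simp_rw [hH]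

theorem lintegral_rpow_dual_weight_eq {v g h : ℝ → ℝ≥0∞} (hv : IsWeight v) (hg : Measurable g)
    {p : ℝ} (hp : 1 < p) (hgh : ∀ᵐ x ∂mu0, g x * v x ^ (1 - p / (p - 1)) = h x) :
    ∫⁻ s, g s ^ p ∂(mu0.withDensity fun x => v x ^ (1 - p / (p - 1))) =
      ∫⁻ t in Ioi (0 : ℝ), h t ^ p * v t := by
  have hp1 : 0 < p - 1 := by linarith
  rw [lintegral_withDensity_mu0 (hv.1.pow_const _) (hg.pow_const _)]
  refine lintegral_congr_ae ?_
  filter_upwards [hgh, hv.2] with x hx hvx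
  rw [← hx, ENNReal.mul_rpow_of_nonneg _ _ (by linarith), ← ENNReal.rpow_mul, mul_assoc]
  congr 1
  conv_rhs => rw [← ENNReal.rpow_one (v x), ← ENNReal.rpow_mul, one_mul,
    ← ENNReal.rpow_add _ _ hvx.1.ne' hvx.2.ne]
  congr 1
  field_simp
  ring

theorem envelopeEnergy_eq {σ u w : ℝ → ℝ≥0∞} (hw : Measurable w) (p q r : ℝ) :
    envelopeEnergy (mu0.withDensity σ) (mu0.withDensity u) (mu0.withDensity w) p q r =
      ∫⁻ x in Ioi (0 : ℝ),
        (⨆ t ∈ Ici x, (∫⁻ s in Ioi t, u s) ^ (1 / r) *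
            (∫⁻ s in Ioc (0 : ℝ) t, σ s) ^ ((p - 1) / p)) ^ (p * q / (p - q)) *
          ((∫⁻ t in Ioc (0 : ℝ) x, w t) ^ (q / (p - q)) * w x) := by
  have hm : Measurable fun x =>
      envelope (mu0.withDensity σ) (mu0.withDensity u) p r x ^ (p * q / (p - q)) *
        mu0.withDensity w (Iic x) ^ (q / (p - q)) :=
    ((antitone_envelope _ _ p r).measurable.pow_const _).mul
      ((measurable_measure_Iic _).pow_const _)
  rw [envelopeEnergy, lintegral_withDensity_mu0 hw hm]
  refine setLIntegral_congr_fun measurableSet_Ioi fun x hx => ?_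
  simp only [envelope]
  rw [withDensity_mu0_Iic, mul_assoc]
  congr 2
  refine iSup_congr fun t => iSup_congr fun ht => ?_
  rw [withDensity_mu0_Iic, withDensity_mu0_Ioi _ (le_trans (le_of_lt hx) ht)]

theorem lowerHardy_eq {σ u w : ℝ → ℝ≥0∞} (hw : Measurable w) (p q r : ℝ) :
    lowerHardy (mu0.withDensity σ)
        ((mu0.withDensity w).withDensity fun x => mu0.withDensity u (Ioi x) ^ (q / r)) p q =
      ∫⁻ x in Ioi (0 : ℝ),
        (∫⁻ t in Ioi x, (∫⁻ s in Ioi t, u s) ^ (q / r) * w t) ^ (q / (p - q)) *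
          ((∫⁻ t in Ioi x, u t) ^ (q / r) *
            ((∫⁻ t in Ioc (0 : ℝ) x, σ t) ^ ((p - 1) * q / (p - q)) * w x)) := by
  have hm : Measurable fun x => mu0.withDensity u (Ioi x) ^ (q / r) :=
    (measurable_measure_Ioi _).pow_const _
  have hm2 : Measurable fun x =>
      (mu0.withDensity w).withDensity (fun x => mu0.withDensity u (Ioi x) ^ (q / r)) (Ioi x) ^
        (q / (p - q)) * mu0.withDensity σ (Iic x) ^ ((p - 1) * q / (p - q)) :=
    ((measurable_measure_Ioi _).pow_const _).mul ((measurable_measure_Iic _).pow_const _)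
  rw [lowerHardy, lintegral_withDensity_eq_lintegral_mul _ hm hm2,
    lintegral_withDensity_mu0 hw (hm.mul hm2)]
  refine setLIntegral_congr_fun measurableSet_Ioi fun x hx => ?_
  have hx0 : 0 ≤ x := le_of_lt hx
  have hκ : ((mu0.withDensity w).withDensity fun x => mu0.withDensity u (Ioi x) ^ (q / r)) (Ioi x) =
      ∫⁻ t in Ioi x, (∫⁻ s in Ioi t, u s) ^ (q / r) * w t := by
    rw [withDensity_apply _ measurableSet_Ioi, setLIntegral_Ioi_withDensity_mu0 hw hm hx0]
    refine setLIntegral_congr_fun measurableSet_Ioi fun t ht => ?_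
    rw [withDensity_mu0_Ioi _ (hx0.trans (le_of_lt ht))]
  simp only [Pi.mul_apply]
  rw [hκ, withDensity_mu0_Ioi _ hx0, withDensity_mu0_Iic]
  ring

theorem lintegral_withDensity_hardy_le {p q r : ℝ} (hp : 1 < p) (hq : 0 < q) {u w v : ℝ → ℝ≥0∞}
    (hu : IsWeight u) (hw : IsWeight w) (hv : IsWeight v) {C : ℝ≥0∞}
    (hC : ∀ h : ℝ → ℝ≥0∞, Measurable h →
      (∫⁻ x in Ioi (0 : ℝ),
          (∫⁻ t in Ioi x, (∫⁻ s in Ioc (0 : ℝ) t, h s) ^ r * u t) ^ (q / r) * w x) ^ (1 / q) ≤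
        C * (∫⁻ t in Ioi (0 : ℝ), h t ^ p * v t) ^ (1 / p))
    {g : ℝ → ℝ≥0∞} (hg : Measurable g) :
    ∫⁻ x, (∫⁻ y in Ioi x, (mu0.withDensity fun x => v x ^ (1 - p / (p - 1))).withDensity g
        (Iic y) ^ r ∂(mu0.withDensity u)) ^ (q / r) ∂(mu0.withDensity w) ≤
      C ^ q * (∫⁻ s, g s ^ p ∂(mu0.withDensity fun x => v x ^ (1 - p / (p - 1)))) ^ (q / p) := by
  have hσ := hv.rpow (1 - p / (p - 1))
  have h1 := hC (fun x => g x * v x ^ (1 - p / (p - 1))) (hg.mul hσ.1)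
  have hae : ∀ᵐ x ∂mu0, g x * v x ^ (1 - p / (p - 1)) = g x * v x ^ (1 - p / (p - 1)) :=
    Filter.Eventually.of_forall fun _ => rfl
  rw [lintegral_hardy_eq hσ.1 hg hu.1 hw.1 hae, lintegral_rpow_dual_weight_eq hv hg hp hae]
  have h2 := ENNReal.rpow_le_rpow h1 hq.le
  rwa [ENNReal.mul_rpow_of_nonneg _ _ hq.le, ← ENNReal.rpow_mul, ← ENNReal.rpow_mul,
    one_div_mul_cancel hq.ne', ENNReal.rpow_one, one_div_mul_eq_div] at h2

theorem exists_hardy_constant {p q r : ℝ} (hp : 1 < p) (hq : 0 < q) {u w v : ℝ → ℝ≥0∞}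
    (hu : IsWeight u) (hw : IsWeight w) (hv : IsWeight v) {K : ℝ≥0∞} (hK : K ≠ ∞)
    (h : ∀ g : ℝ → ℝ≥0∞, Measurable g →
      ∫⁻ s, g s ^ p ∂(mu0.withDensity fun x => v x ^ (1 - p / (p - 1))) ≠ ∞ →
      ∫⁻ x, (∫⁻ y in Ioi x, (mu0.withDensity fun x => v x ^ (1 - p / (p - 1))).withDensity g
          (Iic y) ^ r ∂(mu0.withDensity u)) ^ (q / r) ∂(mu0.withDensity w) ≤
        K * (∫⁻ s, g s ^ p ∂(mu0.withDensity fun x => v x ^ (1 - p / (p - 1)))) ^ (q / p)) :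
    ∃ C : ℝ≥0, 0 < C ∧ ∀ h : ℝ → ℝ≥0∞, Measurable h →
      (∫⁻ x in Ioi (0 : ℝ),
          (∫⁻ t in Ioi x, (∫⁻ s in Ioc (0 : ℝ) t, h s) ^ r * u t) ^ (q / r) * w x) ^ (1 / q) ≤
        (C : ℝ≥0∞) * (∫⁻ t in Ioi (0 : ℝ), h t ^ p * v t) ^ (1 / p) := by
  have hp0 : 0 < p := by linarith
  have hσ := hv.rpow (1 - p / (p - 1))
  have hKq : K ^ (1 / q) ≠ ∞ := ENNReal.rpow_ne_top_of_nonneg (by positivity) hK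
  refine ⟨(K ^ (1 / q)).toNNReal + 1, by positivity, fun f hf => ?_⟩
  have hm : Measurable fun x => f x / v x ^ (1 - p / (p - 1)) := hf.div hσ.1
  have hae : ∀ᵐ x ∂mu0, f x / v x ^ (1 - p / (p - 1)) * v x ^ (1 - p / (p - 1)) = f x :=
    hσ.2.mono fun x hx => ENNReal.div_mul_cancel hx.1.ne' hx.2.ne
  have h1 := h _ hm
  rw [lintegral_hardy_eq hσ.1 hm hu.1 hw.1 hae, lintegral_rpow_dual_weight_eq hv hm hp hae] at h1
  by_cases hN : ∫⁻ t in Ioi (0 : ℝ), f t ^ p * v t = ∞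
  · rw [hN, ENNReal.top_rpow_of_pos (by positivity), ENNReal.mul_top (by simp)]
    exact le_top
  · refine (ENNReal.rpow_le_rpow (h1 hN) (by positivity : 0 ≤ 1 / q)).trans ?_
    rw [ENNReal.mul_rpow_of_nonneg _ _ (by positivity), ← ENNReal.rpow_mul,
      show q / p * (1 / q) = 1 / p by field_simp, ENNReal.coe_add, ENNReal.coe_toNNReal hKq]
    gcongr
    exact le_self_add

theorem withDensity_Iic_lt_top_of_envelopeEnergy {σ u w : ℝ → ℝ≥0∞} (hσ : IsWeight σ)
    (hu : IsWeight u) (hw : IsWeight w) {p q r : ℝ} (hp : 1 < p) (hq : 0 < q) (hqp : q < p)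
    (hr : 0 < r)
    (h : envelopeEnergy (mu0.withDensity σ) (mu0.withDensity u) (mu0.withDensity w) p q r ≠ ∞)
    (x : ℝ) : mu0.withDensity w (Iic x) < ∞ := by
  have hpq : 0 < p - q := by linarith
  have hp0 : 0 < p := by linarith
  have hp1 : 0 < p - 1 := by linarith
  rcases le_or_gt x 0 with hx | hx
  · rw [withDensity_mu0_Iic_of_nonpos w hx]
    exact ENNReal.zero_lt_top
  by_contra! htop
  have hae := ae_lt_top (((antitone_envelope _ _ p r).measurable.pow_const
    _).mul ((measurable_measure_Iic _).pow_const _)) h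
  refine hw.withDensity_ne_zero (mu0_Ioi_ne_zero x) (measure_mono_null (fun y hy => ?_) hae)
  have hxy : x < y := hy
  have hWy : mu0.withDensity w (Iic y) = ∞ :=
    top_le_iff.1 (htop.trans (monotone_measure_Iic _ hxy.le))
  have hpos : 0 < envelope (mu0.withDensity σ) (mu0.withDensity u) p r y := by
    refine lt_of_lt_of_le ?_ (le_envelope _ _ p r le_rfl)
    refine ENNReal.mul_pos (fun h0 => ?_) (fun h0 => ?_)
    · exact hu.withDensity_ne_zero (mu0_Ioi_ne_zero y)
        ((ENNReal.rpow_eq_zero_iff_of_pos (by positivity)).1 h0)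
    · exact hσ.withDensity_ne_zero (mu0_Iic_ne_zero (hx.trans hxy))
        ((ENNReal.rpow_eq_zero_iff_of_pos (by positivity)).1 h0)
  simp only [Pi.mul_apply, mem_compl_iff, mem_ofPred_eq, not_lt, top_le_iff]
  rw [hWy, ENNReal.top_rpow_of_pos (by positivity), ENNReal.mul_top]
  exact fun h0 => hpos.ne' ((ENNReal.rpow_eq_zero_iff_of_pos (by positivity)).1 h0)

theorem withDensity_lt_top_of_hardy {σ u w : ℝ → ℝ≥0∞} (hσ : IsWeight σ) (hu : IsWeight u)
    (hw : IsWeight w) {p q r : ℝ} (hp : 1 < p) (hq : 0 < q) (hr : 0 < r) {K : ℝ≥0∞} (hK : K ≠ ∞)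
    (h : ∀ g : ℝ → ℝ≥0∞, Measurable g →
      ∫⁻ x, (∫⁻ y in Ioi x, (mu0.withDensity σ).withDensity g (Iic y) ^ r ∂(mu0.withDensity u)) ^
        (q / r) ∂(mu0.withDensity w) ≤ K * (∫⁻ s, g s ^ p ∂(mu0.withDensity σ)) ^ (q / p))
    {t : ℝ} (ht : 0 < t) (hV : mu0.withDensity σ (Iic t) < ∞) :
    mu0.withDensity u (Ioi t) < ∞ ∧ mu0.withDensity w (Iic t) < ∞ := by
  have hp0 : 0 < p := by linarith
  have hp1 : 0 < p - 1 := by linarith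
  have h1 := rpow_mul_measure_Iic_le (mu0.withDensity σ) (mu0.withDensity u) (mu0.withDensity w)
    hp hq hr h hV
  have hU0 : mu0.withDensity u (Ioi t) ^ (1 / r) ≠ 0 := fun h0 =>
    hu.withDensity_ne_zero (mu0_Ioi_ne_zero t)
      ((ENNReal.rpow_eq_zero_iff_of_pos (by positivity)).1 h0)
  have hV0 : mu0.withDensity σ (Iic t) ^ ((p - 1) / p) ≠ 0 := fun h0 =>
    hσ.withDensity_ne_zero (mu0_Iic_ne_zero ht)
      ((ENNReal.rpow_eq_zero_iff_of_pos (by positivity)).1 h0)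
  have hW0 : mu0.withDensity w (Iic t) ≠ 0 := hw.withDensity_ne_zero (mu0_Iic_ne_zero ht)
  refine ⟨lt_top_iff_ne_top.2 fun htop => hK ?_, lt_top_iff_ne_top.2 fun htop => hK ?_⟩
  · rw [htop, ENNReal.top_rpow_of_pos (by positivity), ENNReal.top_mul hV0,
      ENNReal.top_rpow_of_pos hq, ENNReal.top_mul hW0] at h1
    exact top_le_iff.1 h1
  · rw [htop, ENNReal.mul_top] at h1
    · exact top_le_iff.1 h1
    · exact fun h0 => mul_ne_zero hU0 hV0 ((ENNReal.rpow_eq_zero_iff_of_pos hq).1 h0)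

theorem hardy_energies_lt_top {σ u w : ℝ → ℝ≥0∞} (hσ : IsWeight σ) (hu : IsWeight u)
    (hw : IsWeight w) {p q r : ℝ} (hp : 1 < p) (hq : 0 < q) (hqp : q < p) (hr : 0 < r)
    {K : ℝ≥0∞} (hK : K ≠ ∞) (hV : ∀ x, mu0.withDensity σ (Iic x) < ∞)
    (h : ∀ g : ℝ → ℝ≥0∞, Measurable g →
      ∫⁻ x, (∫⁻ y in Ioi x, (mu0.withDensity σ).withDensity g (Iic y) ^ r ∂(mu0.withDensity u)) ^
        (q / r) ∂(mu0.withDensity w) ≤ K * (∫⁻ s, g s ^ p ∂(mu0.withDensity σ)) ^ (q / p)) :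
    envelopeEnergy (mu0.withDensity σ) (mu0.withDensity u) (mu0.withDensity w) p q r < ∞ ∧
      lowerHardy (mu0.withDensity σ)
        ((mu0.withDensity w).withDensity fun x => mu0.withDensity u (Ioi x) ^ (q / r)) p q < ∞ := by
  have hfin : ∀ t, 0 < t → mu0.withDensity u (Ioi t) < ∞ ∧ mu0.withDensity w (Iic t) < ∞ :=
    fun t ht => withDensity_lt_top_of_hardy hσ hu hw hp hq hr hK h ht (hV t)
  have hW : ∀ x, mu0.withDensity w (Iic x) < ∞ := fun x => by
    rcases le_or_gt x 0 with hx | hx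
    · rw [withDensity_mu0_Iic_of_nonpos w hx]
      exact ENNReal.zero_lt_top
    · exact (hfin x hx).2
  have : SigmaFinite (mu0.withDensity w) :=
    SigmaFinite.withDensity_of_ne_top (hw.2.mono fun _ hx => hx.2.ne)
  have hκ : ∀ᵐ x ∂(mu0.withDensity w), mu0.withDensity u (Ioi x) ^ (q / r) ≠ ∞ := by
    refine (withDensity_absolutelyContinuous mu0 w).ae_le ?_
    filter_upwards [ae_restrict_mem (μ := volume) (measurableSet_Ioi (a := (0 : ℝ)))] with x hx
    exact ENNReal.rpow_ne_top_of_nonneg (by positivity) (hfin x hx).1.ne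
  have : SigmaFinite
      ((mu0.withDensity w).withDensity fun x => mu0.withDensity u (Ioi x) ^ (q / r)) :=
    SigmaFinite.withDensity_of_ne_top hκ
  exact ⟨envelopeEnergy_lt_top _ _ _ hp hq hqp hr hK h hV hW,
    lowerHardy_lt_top _ _ hp hq hqp hK hV fun g hg =>
      (lintegral_withDensity_rpow_le _ _ (monotone_measure_Iic _) hq hr).trans (h g hg)⟩

theorem statement13 (p q r : ℝ) (hq : 0 < q) (hr : 0 < r) (hp : 1 < p) (hqp : q < p) (hpr : p ≤ r)
    (u w v : ℝ → ℝ≥0∞) (hu : IsWeight u) (hw : IsWeight w) (hv : IsWeight v)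
    (hvfin : ∀ x ∈ Ioi (0 : ℝ), (∫⁻ t in Ioc (0 : ℝ) x, v t ^ (1 - p / (p - 1))) < ∞) :
    (∃ C : ℝ≥0, 0 < C ∧ ∀ h : ℝ → ℝ≥0∞, Measurable h →
        (∫⁻ x in Ioi (0 : ℝ),
            (∫⁻ t in Ioi x, (∫⁻ s in Ioc (0 : ℝ) t, h s) ^ r * u t) ^ (q / r) * w x) ^
          (1 / q) ≤
          (C : ℝ≥0∞) * (∫⁻ t in Ioi (0 : ℝ), h t ^ p * v t) ^ (1 / p)) ↔
      (((∫⁻ x in Ioi (0 : ℝ),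
        (⨆ t ∈ Ici x, (∫⁻ s in Ioi t, u s) ^ (1 / r) *
            (∫⁻ s in Ioc (0 : ℝ) t, v s ^ (1 - p / (p - 1))) ^ ((p - 1) / p)) ^
            (p * q / (p - q)) *
          ((∫⁻ t in Ioc (0 : ℝ) x, w t) ^ (q / (p - q)) * w x)) ^ ((p - q) / (p * q))) < ∞ ∧
      ((∫⁻ x in Ioi (0 : ℝ),
        (∫⁻ t in Ioi x, (∫⁻ s in Ioi t, u s) ^ (q / r) * w t) ^ (q / (p - q)) *
          ((∫⁻ t in Ioi x, u t) ^ (q / r) *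
            ((∫⁻ t in Ioc (0 : ℝ) x, v t ^ (1 - p / (p - 1))) ^ ((p - 1) * q / (p - q)) *
              w x))) ^ ((p - q) / (p * q))) < ∞) := by
  have hp0 : 0 < p := by linarith
  have hpq : 0 < p - q := by linarith
  have hσ := hv.rpow (1 - p / (p - 1))
  have hV : ∀ x, mu0.withDensity (fun x => v x ^ (1 - p / (p - 1))) (Iic x) < ∞ := fun x => by
    rcases le_or_gt x 0 with hx | hx
    · rw [withDensity_mu0_Iic_of_nonpos _ hx]
      exact ENNReal.zero_lt_top
    · rw [withDensity_mu0_Iic]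
      exact hvfin x hx
  rw [ENNReal.rpow_lt_top_iff_of_pos (by positivity),
    ENNReal.rpow_lt_top_iff_of_pos (by positivity),
    ← envelopeEnergy_eq (σ := fun s => v s ^ (1 - p / (p - 1))) hw.1,
    ← lowerHardy_eq (σ := fun s => v s ^ (1 - p / (p - 1))) hw.1]
  constructor
  · rintro ⟨C, -, hC⟩
    exact hardy_energies_lt_top hσ hu hw hp hq hqp hr
      (ENNReal.rpow_ne_top_of_nonneg hq.le ENNReal.coe_ne_top) hV
      fun g hg => lintegral_withDensity_hardy_le hp hq hu hw hv hC hg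
  · rintro ⟨h3, h4⟩
    refine exists_hardy_constant hp hq hu hw hv ?_ fun g hg hN =>
      lintegral_rpow_tail_le _ _ _ hg hp hq hqp hpr hV
        (withDensity_Iic_lt_top_of_envelopeEnergy hσ hu hw hp hq hqp hr h3.ne) hN
    have hθ : 0 ≤ (p - q) / p := by positivity
    have hE := ENNReal.rpow_ne_top_of_nonneg hθ h3.ne
    have hL := ENNReal.rpow_ne_top_of_nonneg hθ h4.ne
    have h2 : (2 : ℝ≥0∞) ^ q ≠ ∞ := ENNReal.rpow_ne_top_of_nonneg hq.le ENNReal.ofNat_ne_top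
    have h4 : (4 : ℝ≥0∞) ^ q ≠ ∞ := ENNReal.rpow_ne_top_of_nonneg hq.le ENNReal.ofNat_ne_top
    finiteness
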